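/- Let k ≥ 2, let f ∈ C^k([0,1] × ℝ) satisfy m ≤ ∂f/∂y(x,y) ≤ γ for all (x,y) with m > 0, and fix q > 0 and the Bakhvalov-type mesh data ε* ∈ (0,1/8), p ∈ ((ε*)^{1/3}, 1/2), a > 0 (with ω ≥ 0). Then there exists a constant C > 0 independent of N and ε such that for every ε ∈ (0, ε*] and every even N ≥ 4, the exact solution y of ε²y'' = f(x,y), y(0) = y(1) = 0 and the unique solution ȳ of the discrete problem F ȳ = 0 on the Bakhvalov-type mesh satisfy max_{0 ≤ i ≤ N} |y(xᵢ) − ȳᵢ| ≤ C/N². -/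

import Mathlib

/-- The boundary-layer part `κ(t) = aεt/(p-t)` of the Bakhvalov-type mesh generating
function. -/
noncomputable def bkappa (a ε p : ℝ) (t : ℝ) : ℝ := a * ε * t / (p - t)

/-- The coefficient `ω` of the cubic part, determined by `π(1/2) = 1/2`, where
`α = p - ε^{1/3}`. -/
noncomputable def bomega (a ε p : ℝ) : ℝ :=
  (1 / 2 - (p - ε ^ ((1:ℝ)/3)))⁻¹ ^ 3 *
    (1 / 2 - a * (p * (1 / 2 - (p - ε ^ ((1:ℝ)/3))) ^ 2
      + p * (1 / 2 - (p - ε ^ ((1:ℝ)/3))) * ε ^ ((1:ℝ)/3)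
      + (p - ε ^ ((1:ℝ)/3)) * ε ^ ((2:ℝ)/3)))

/-- The cubic part `π(t) = ω(t-α)³ + κ''(α)(t-α)²/2 + κ'(α)(t-α) + κ(α)`, with
`α = p - ε^{1/3}`, `κ'(α) = aεp/(p-α)²`, `κ''(α) = 2aεp/(p-α)³`. -/
noncomputable def bpi (a ε p : ℝ) (t : ℝ) : ℝ :=
  bomega a ε p * (t - (p - ε ^ ((1:ℝ)/3))) ^ 3
    + (2 * a * ε * p / (p - (p - ε ^ ((1:ℝ)/3))) ^ 3) * (t - (p - ε ^ ((1:ℝ)/3))) ^ 2 / 2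
    + (a * ε * p / (p - (p - ε ^ ((1:ℝ)/3))) ^ 2) * (t - (p - ε ^ ((1:ℝ)/3)))
    + bkappa a ε p (p - ε ^ ((1:ℝ)/3))

/-- The Bakhvalov-type mesh generating function: `φ = κ` on `[0, α]`, `φ = π` on
`[α, 1/2]`, and `φ(t) = 1 - φ(1-t)` on `[1/2, 1]`. -/
noncomputable def bphi (a ε p : ℝ) (t : ℝ) : ℝ :=
  if t ≤ 1 / 2 then
    (if t ≤ p - ε ^ ((1:ℝ)/3) then bkappa a ε p t else bpi a ε p t)
  else
    1 - (if 1 - t ≤ p - ε ^ ((1:ℝ)/3) then bkappa a ε p (1 - t) else bpi a ε p (1 - t))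

/-- The discrete operator `F` of the fitted difference scheme on a mesh
`0 = x₀ < x₁ < ⋯ < x_N = 1`, with `aᵢ = 1/sinh(β h_{i-1})`, `dᵢ = 1/tanh(β h_{i-1})`,
`Δdᵢ = dᵢ - aᵢ`. -/
noncomputable def schemeF (N : ℕ) (x : ℕ → ℝ) (f : ℝ → ℝ → ℝ) (γ q β : ℝ)
    (y : Fin (N + 1) → ℝ) : Fin (N + 1) → ℝ := fun i =>
  let Y : ℕ → ℝ := fun j => if h : j < N + 1 then y ⟨j, h⟩ else 0
  let a : ℕ → ℝ := fun j => 1 / Real.sinh (β * (x j - x (j - 1)))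
  let d : ℕ → ℝ := fun j => 1 / Real.tanh (β * (x j - x (j - 1)))
  let Δd : ℕ → ℝ := fun j => d j - a j
  if i.val = 0 then Y 0
  else if i.val = N then Y N
  else
    γ / (Δd i.val + Δd (i.val + 1)) *
      (((q + 1) * a i.val + d i.val + Δd (i.val + 1)) * (Y (i.val - 1) - Y i.val)
        - ((q + 1) * a (i.val + 1) + d (i.val + 1) + Δd i.val) * (Y i.val - Y (i.val + 1))
        - (f (x (i.val - 1)) (Y (i.val - 1)) + q * f (x i.val) (Y i.val)
            + f (x (i.val + 1)) (Y (i.val + 1))) / γ * (Δd i.val + Δd (i.val + 1)))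

section

open Set

/-- Integrating a power bound on a derivative over `[0, 1]`. -/
lemma abs_sub_le_of_abs_deriv_le_pow {U U' : ℝ → ℝ} {K : ℝ} {n : ℕ}
    (hU : ∀ s ∈ Icc (0:ℝ) 1, HasDerivWithinAt U (U' s) (Icc 0 1) s)
    (hb : ∀ s ∈ Icc (0:ℝ) 1, |U' s| ≤ K * s ^ n) :
    ∀ s ∈ Icc (0:ℝ) 1, |U s - U 0| ≤ K / (n + 1) * s ^ (n + 1) := by
  intro s hs
  have h := image_norm_le_of_norm_deriv_right_le_deriv_boundary (a := (0:ℝ)) (b := 1)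
    (f := fun s => U s - U 0) (f' := U') (B := fun s => K / (n + 1) * s ^ (n + 1))
    (B' := fun s => K * s ^ n) ?_ ?_ ?_ ?_ ?_ hs
  · simpa [Real.norm_eq_abs] using h
  · intro t ht
    exact ((hU t ht).continuousWithinAt).sub continuousWithinAt_const
  · intro t ht
    have h1 := (hU t ⟨ht.1, ht.2.le⟩).sub_const (U 0)
    exact h1.mono_of_mem_nhdsWithin (Icc_mem_nhdsGE_of_mem ht)
  · simp
  · intro t
    have h1 := (hasDerivAt_pow (n + 1) t).const_mul (K / (n + 1 : ℝ))
    refine h1.congr_deriv ?_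
    push_cast
    field_simp
  · intro t ht
    simpa [Real.norm_eq_abs] using hb t ⟨ht.1, ht.2.le⟩

lemma hasDerivWithinAt_segment {A B x x' : ℝ} {u u' : ℝ → ℝ}
    (hu : ∀ t ∈ Icc A B, HasDerivWithinAt u (u' t) (Icc A B) t)
    (hx : x ∈ Icc A B) (hx' : x' ∈ Icc A B) :
    ∀ s ∈ Icc (0:ℝ) 1, HasDerivWithinAt (fun s => u (x + s * (x' - x)))
      ((x' - x) * u' (x + s * (x' - x))) (Icc 0 1) s := by
  have hm : MapsTo (fun s => x + s * (x' - x)) (Icc (0:ℝ) 1) (Icc A B) := by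
    intro s hs
    have := (convex_Icc A B).add_smul_sub_mem hx hx' hs
    simpa using this
  intro s hs
  have h1 : HasDerivWithinAt (fun s => x + s * (x' - x)) (x' - x) (Icc (0:ℝ) 1) s := by
    have := ((hasDerivAt_id s).mul_const (x' - x)).const_add x
    simpa using this.hasDerivWithinAt
  have := (hu _ (hm hs)).comp s h1 hm
  simpa [mul_comm, Function.comp_def] using this

lemma segment_mem_uIcc (x x' : ℝ) : ∀ s ∈ Icc (0:ℝ) 1, x + s * (x' - x) ∈ uIcc x x' := by
  intro s hs
  have := (convex_uIcc x x').add_smul_sub_mem left_mem_uIcc right_mem_uIcc hs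
  simpa using this

/-- First-order Taylor expansion with a second-order remainder bound. -/
lemma abs_taylor_two_le {A B x x' K : ℝ} {u u1 u2 : ℝ → ℝ}
    (hu : ∀ t ∈ Icc A B, HasDerivWithinAt u (u1 t) (Icc A B) t)
    (hu1 : ∀ t ∈ Icc A B, HasDerivWithinAt u1 (u2 t) (Icc A B) t)
    (hx : x ∈ Icc A B) (hx' : x' ∈ Icc A B) (hK : ∀ t ∈ uIcc x x', |u2 t| ≤ K) :
    |u x' - u x - (x' - x) * u1 x| ≤ K / 2 * (x' - x) ^ 2 := by
  set d := x' - x with hd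
  have h1 := hasDerivWithinAt_segment hu hx hx'
  have h2 := hasDerivWithinAt_segment hu1 hx hx'
  have b1 := abs_sub_le_of_abs_deriv_le_pow (K := |d| * K) (n := 0) h2 (by
    intro s hs
    rw [abs_mul, pow_zero, mul_one]
    exact mul_le_mul_of_nonneg_left (hK _ (segment_mem_uIcc x x' s hs)) (abs_nonneg _))
  have b2 := abs_sub_le_of_abs_deriv_le_pow (K := |d| * (|d| * K)) (n := 1)
    (U := fun s => u (x + s * d) - s * (d * u1 x))
    (U' := fun s => d * u1 (x + s * d) - d * u1 x) (by
      intro s hs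
      have := ((hasDerivAt_id s).mul_const (d * u1 x)).hasDerivWithinAt (s := Icc (0:ℝ) 1)
      exact ((h1 s hs).sub this).congr_deriv (by ring)) (by
      intro s hs
      have := b1 s hs
      rw [← mul_sub, abs_mul, mul_assoc]
      refine mul_le_mul_of_nonneg_left ?_ (abs_nonneg _)
      simpa using this) 1 (by simp)
  have e : |d| * (|d| * K) = K * d ^ 2 := by rw [← mul_assoc, abs_mul_abs_self]; ring
  rw [e] at b2
  have e2 : x + 1 * d = x' := by rw [hd]; ring
  simp only [e2] at b2
  norm_num at b2
  calc _ = |u x' - d * u1 x - u x| := by congr 1; ring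
    _ ≤ _ := b2
    _ = _ := by ring

/-- Third-order Taylor expansion with a fourth-order remainder bound. -/
lemma abs_taylor_four_le {A B x x' K : ℝ} {u u1 u2 u3 u4 : ℝ → ℝ}
    (hu : ∀ t ∈ Icc A B, HasDerivWithinAt u (u1 t) (Icc A B) t)
    (hu1 : ∀ t ∈ Icc A B, HasDerivWithinAt u1 (u2 t) (Icc A B) t)
    (hu2 : ∀ t ∈ Icc A B, HasDerivWithinAt u2 (u3 t) (Icc A B) t)
    (hu3 : ∀ t ∈ Icc A B, HasDerivWithinAt u3 (u4 t) (Icc A B) t)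
    (hx : x ∈ Icc A B) (hx' : x' ∈ Icc A B) (hK : ∀ t ∈ uIcc x x', |u4 t| ≤ K) :
    |u x' - u x - (x' - x) * u1 x - (x' - x) ^ 2 / 2 * u2 x - (x' - x) ^ 3 / 6 * u3 x|
      ≤ K / 24 * (x' - x) ^ 4 := by
  set d := x' - x with hd
  have h1 := hasDerivWithinAt_segment hu hx hx'
  have h2 := hasDerivWithinAt_segment hu1 hx hx'
  have hseg : ∀ s ∈ Icc (0:ℝ) 1, x + s * d ∈ Icc A B := fun s hs =>
    uIcc_subset_Icc hx hx' (segment_mem_uIcc x x' s hs)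
  have b2 : ∀ s ∈ Icc (0:ℝ) 1, |u2 (x + s * d) - u2 x - s * d * u3 x| ≤ K / 2 * d ^ 2 * s ^ 2 := by
    intro s hs
    have := abs_taylor_two_le hu2 hu3 hx (hseg s hs) (K := K) (by
      intro t ht
      exact hK t (uIcc_subset_uIcc left_mem_uIcc (segment_mem_uIcc x x' s hs) ht))
    calc _ = |u2 (x + s * d) - u2 x - (x + s * d - x) * u3 x| := by congr 2; ring
      _ ≤ _ := this
      _ = _ := by ring
  have p1 : ∀ s : ℝ, HasDerivWithinAt (fun s : ℝ => s * (d * u2 x) + s ^ 2 * (d ^ 2 * u3 x / 2))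
      (d * u2 x + s * (d ^ 2 * u3 x)) (Icc (0:ℝ) 1) s := by
    intro s
    have := ((hasDerivAt_id s).mul_const (d * u2 x)).add
      ((hasDerivAt_pow 2 s).mul_const (d ^ 2 * u3 x / 2))
    refine (this.congr_deriv ?_).hasDerivWithinAt
    norm_num; ring
  have b3 := abs_sub_le_of_abs_deriv_le_pow (K := |d| * (K / 2 * d ^ 2)) (n := 2)
    (U := fun s => u1 (x + s * d) - (s * (d * u2 x) + s ^ 2 * (d ^ 2 * u3 x / 2)))
    (U' := fun s => d * u2 (x + s * d) - (d * u2 x + s * (d ^ 2 * u3 x)))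
    (fun s hs => (h2 s hs).sub (p1 s)) (by
      intro s hs
      have := b2 s hs
      calc _ = |d * (u2 (x + s * d) - u2 x - s * d * u3 x)| := by congr 1; ring
        _ = |d| * _ := abs_mul _ _
        _ ≤ |d| * (K / 2 * d ^ 2 * s ^ 2) := mul_le_mul_of_nonneg_left this (abs_nonneg _)
        _ = _ := by ring)
  have p2 : ∀ s : ℝ, HasDerivWithinAt (fun s : ℝ => s * (d * u1 x) + s ^ 2 * (d ^ 2 * u2 x / 2)
        + s ^ 3 * (d ^ 3 * u3 x / 6))
      (d * (u1 x + (s * (d * u2 x) + s ^ 2 * (d ^ 2 * u3 x / 2)))) (Icc (0:ℝ) 1) s := by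
    intro s
    have := (((hasDerivAt_id s).mul_const (d * u1 x)).add
      ((hasDerivAt_pow 2 s).mul_const (d ^ 2 * u2 x / 2))).add
      ((hasDerivAt_pow 3 s).mul_const (d ^ 3 * u3 x / 6))
    refine (this.congr_deriv ?_).hasDerivWithinAt
    norm_num; ring
  have b4 := abs_sub_le_of_abs_deriv_le_pow (K := |d| * (|d| * (K / 2 * d ^ 2) / 3)) (n := 3)
    (U := fun s => u (x + s * d) - (s * (d * u1 x) + s ^ 2 * (d ^ 2 * u2 x / 2)
        + s ^ 3 * (d ^ 3 * u3 x / 6)))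
    (U' := fun s => d * u1 (x + s * d)
      - d * (u1 x + (s * (d * u2 x) + s ^ 2 * (d ^ 2 * u3 x / 2))))
    (fun s hs => (h1 s hs).sub (p2 s)) (by
      intro s hs
      have := b3 s hs
      norm_num at this
      rw [← mul_sub, abs_mul, mul_assoc]
      refine mul_le_mul_of_nonneg_left ?_ (abs_nonneg _)
      calc _ = |u1 (x + s * d) - (s * (d * u2 x) + s ^ 2 * (d ^ 2 * u3 x / 2)) - u1 x| := by
            congr 1; ring
        _ ≤ _ := this
        _ = _ := by ring) 1 (by simp)
  have e : |d| * (|d| * (K / 2 * d ^ 2) / 3) = K * d ^ 4 / 6 := by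
    have := abs_mul_abs_self d
    linear_combination (K / 6 * d ^ 2) * this
  rw [e] at b4
  have e2 : x + 1 * d = x' := by rw [hd]; ring
  simp only [e2] at b4
  norm_num at b4
  calc _ = |u x' - (d * u1 x + d ^ 2 * u2 x / 2 + d ^ 3 * u3 x / 6) - u x| := by congr 1; ring
    _ ≤ _ := b4
    _ = _ := by ring

/-- Maximum principle: a function that is strictly convex wherever it is positive and is
nonpositive at the end points is nonpositive. -/
lemma nonpos_of_deriv_two_pos {A B : ℝ} {w w1 w2 : ℝ → ℝ}
    (hw : ∀ t ∈ Icc A B, HasDerivWithinAt w (w1 t) (Icc A B) t)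
    (hw1 : ∀ t ∈ Icc A B, HasDerivWithinAt w1 (w2 t) (Icc A B) t)
    (hA : w A ≤ 0) (hB : w B ≤ 0)
    (hpos : ∀ t ∈ Ioo A B, 0 < w t → 0 < w2 t) :
    ∀ t ∈ Icc A B, w t ≤ 0 := by
  by_contra! hcon
  obtain ⟨t0, ht0, h0⟩ := hcon
  have hcont : ContinuousOn w (Icc A B) := fun t ht => (hw t ht).continuousWithinAt
  obtain ⟨x, hx, hmax⟩ := isCompact_Icc.exists_isMaxOn ⟨t0, ht0⟩ hcont
  have hxpos : 0 < w x := h0.trans_le (hmax ht0)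
  have hxo : x ∈ Ioo A B := by
    refine ⟨lt_of_le_of_ne hx.1 ?_, lt_of_le_of_ne hx.2 ?_⟩
    · rintro rfl; linarith
    · rintro rfl; linarith
  have hd : ∀ t ∈ Ioo A B, HasDerivAt w (w1 t) t := fun t ht =>
    (hw t (Ioo_subset_Icc_self ht)).hasDerivAt (Icc_mem_nhds ht.1 ht.2)
  have hd1 : HasDerivAt w1 (w2 x) x := (hw1 x hx).hasDerivAt (Icc_mem_nhds hxo.1 hxo.2)
  have hev : deriv w =ᶠ[nhds x] w1 := by
    filter_upwards [Ioo_mem_nhds hxo.1 hxo.2] with t ht using (hd t ht).deriv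
  have hlmax : IsLocalMax w x := by
    filter_upwards [Icc_mem_nhds hxo.1 hxo.2] with t ht using hmax ht
  have hw1x : w1 x = 0 := hlmax.hasDerivAt_eq_zero (hd x hxo)
  have hdd : deriv (deriv w) x = w2 x := by rw [hev.deriv_eq]; exact hd1.deriv
  have hlmin : IsLocalMin w x := isLocalMin_of_deriv_deriv_pos
    (by rw [hdd]; exact hpos x hxo hxpos) (by rw [(hd x hxo).deriv, hw1x])
    (hd x hxo).continuousAt
  have hconst : w =ᶠ[nhds x] fun _ => w x := by
    filter_upwards [hlmax, hlmin] with t h1 h2 using le_antisymm h1 h2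
  have h3 : deriv w =ᶠ[nhds x] fun _ => 0 := by
    have := hconst.deriv
    simpa using this
  have h4 : deriv (deriv w) x = 0 := by rw [h3.deriv_eq]; simp
  have := hpos x hxo hxpos
  rw [← hdd, h4] at this
  exact lt_irrefl _ this

/-- `halfTanh z = tanh (z/2)`, in the form in which it occurs in the scheme. -/
noncomputable def halfTanh (z : ℝ) : ℝ := (Real.cosh z - 1) / Real.sinh z

lemma halfTanh_eq {z : ℝ} (hz : 0 < z) : halfTanh z = 1 - 2 / (Real.exp z + 1) := by
  have h1 : 1 < Real.exp z := Real.one_lt_exp_iff.2 hz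
  have h2 : Real.sinh z ≠ 0 := (Real.sinh_pos_iff.2 hz).ne'
  unfold halfTanh
  rw [div_eq_iff h2, Real.cosh_eq, Real.sinh_eq, Real.exp_neg]
  field_simp
  ring

lemma halfTanh_pos {z : ℝ} (hz : 0 < z) : 0 < halfTanh z :=
  div_pos (sub_pos.2 (Real.one_lt_cosh.2 hz.ne')) (Real.sinh_pos_iff.2 hz)

lemma halfTanh_mono {z w : ℝ} (hz : 0 < z) (hzw : z ≤ w) : halfTanh z ≤ halfTanh w := by
  rw [halfTanh_eq hz, halfTanh_eq (hz.trans_le hzw)]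
  have : Real.exp z ≤ Real.exp w := Real.exp_le_exp.2 hzw
  gcongr

lemma sq_div_two_add_le_cosh {z : ℝ} (hz : 0 ≤ z) :
    z ^ 2 / 2 + z ^ 4 / 32 ≤ Real.cosh z - 1 := by
  have h1 : z / 4 ≤ Real.sinh (z / 4) := Real.self_le_sinh_iff.2 (by positivity)
  have h4 : 0 ≤ Real.sinh (z / 4) := le_trans (by positivity) h1
  have h2 : 1 + z ^ 2 / 32 ≤ Real.cosh (z / 4) := by
    have e1 := Real.cosh_two_mul (z / 8)
    have e2 := Real.cosh_sq (z / 8)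
    have e3 : z / 8 ≤ Real.sinh (z / 8) := Real.self_le_sinh_iff.2 (by positivity)
    rw [show 2 * (z / 8) = z / 4 by ring] at e1
    nlinarith
  have h3 : z / 2 + z ^ 3 / 64 ≤ Real.sinh (z / 2) := by
    have e : Real.sinh (z / 2) = 2 * Real.sinh (z / 4) * Real.cosh (z / 4) := by
      rw [← Real.sinh_two_mul]; ring_nf
    rw [e]
    have : z / 4 * (1 + z ^ 2 / 32) ≤ Real.sinh (z / 4) * Real.cosh (z / 4) :=
      mul_le_mul h1 h2 (by positivity) h4
    nlinarith
  have e : Real.cosh z = 1 + 2 * Real.sinh (z / 2) ^ 2 := by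
    have h := Real.cosh_two_mul (z / 2)
    rw [mul_div_cancel₀ z two_ne_zero] at h
    have := Real.cosh_sq (z / 2)
    linarith
  rw [e]
  have : (z / 2 + z ^ 3 / 64) ^ 2 ≤ Real.sinh (z / 2) ^ 2 := by
    gcongr
  nlinarith [pow_nonneg hz 6]

lemma abs_sq_div_sinh_sub_le {z : ℝ} (hz : 0 < z) :
    |z ^ 2 / Real.sinh z - 2 * halfTanh z| ≤ z ^ 2 * halfTanh z := by
  have hs := Real.sinh_pos_iff.2 hz
  have hc := sq_div_two_add_le_cosh hz.le
  unfold halfTanh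
  rw [show z ^ 2 / Real.sinh z - 2 * ((Real.cosh z - 1) / Real.sinh z)
    = (z ^ 2 - 2 * (Real.cosh z - 1)) / Real.sinh z by ring, abs_div, abs_of_pos hs,
    ← mul_div_assoc]
  refine div_le_div_of_nonneg_right ?_ hs.le
  rw [abs_le]
  have hp : 0 ≤ z ^ 4 := by positivity
  refine ⟨?_, by nlinarith [mul_nonneg (sq_nonneg z) (show 0 ≤ Real.cosh z - 1 by nlinarith [sq_nonneg z])]⟩
  rcases le_or_gt 2 (z ^ 2) with h | h
  · nlinarith [sq_nonneg z]
  · have h1 := Real.cosh_le_exp_half_sq z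
    have h2 : Real.exp (z ^ 2 / 2) * (1 - z ^ 2 / 2) ≤ 1 := by
      have h3 := Real.add_one_le_exp (-(z ^ 2 / 2))
      calc _ ≤ Real.exp (z ^ 2 / 2) * Real.exp (-(z ^ 2 / 2)) := by
            refine mul_le_mul_of_nonneg_left (by linarith) (Real.exp_pos _).le
        _ = 1 := by rw [← Real.exp_add]; simp
    have h3 : Real.cosh z * (1 - z ^ 2 / 2) ≤ 1 :=
      le_trans (mul_le_mul_of_nonneg_right h1 (by linarith)) h2
    nlinarith

lemma pow_four_div_sinh_le {z : ℝ} (hz : 0 < z) :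
    z ^ 4 / Real.sinh z ≤ 2 * (z ^ 2 * halfTanh z) := by
  have hs := Real.sinh_pos_iff.2 hz
  have hc := sq_div_two_add_le_cosh hz.le
  unfold halfTanh
  rw [show 2 * (z ^ 2 * ((Real.cosh z - 1) / Real.sinh z))
    = (2 * z ^ 2 * (Real.cosh z - 1)) / Real.sinh z by ring]
  refine div_le_div_of_nonneg_right ?_ hs.le
  nlinarith [sq_nonneg z, sq_nonneg (z ^ 2)]

lemma abs_deriv_div_sinh_le {z : ℝ} (hz : 0 < z) :
    |(Real.sinh z - z * Real.cosh z) / Real.sinh z ^ 2| ≤ halfTanh z := by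
  have hs := Real.sinh_pos_iff.2 hz
  have h1 := Real.self_le_sinh_iff.2 hz.le
  have h0 := Real.one_le_cosh z
  have h2 : Real.sinh z ≤ z * Real.cosh z := by
    have h := (convex_Icc 0 z).norm_image_sub_le_of_norm_hasDerivWithin_le
      (f := Real.sinh) (f' := Real.cosh) (C := Real.cosh z) (x := 0) (y := z)
      (fun t _ => (Real.hasDerivAt_sinh t).hasDerivWithinAt)
      (fun t ht => by
        rw [Real.norm_eq_abs, abs_of_pos (Real.cosh_pos t), Real.cosh_le_cosh, abs_of_nonneg ht.1,
          abs_of_pos hz]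
        exact ht.2) ⟨le_rfl, hz.le⟩ ⟨hz.le, le_rfl⟩
    simp only [Real.sinh_zero, sub_zero, Real.norm_eq_abs, abs_of_pos hs, abs_of_pos hz] at h
    linarith
  unfold halfTanh
  rw [abs_div, abs_of_pos (pow_pos hs 2), div_le_div_iff₀ (pow_pos hs 2) hs]
  rw [abs_of_nonpos (by linarith)]
  nlinarith [mul_nonneg hs.le (mul_nonneg (sub_nonneg.2 h1) (by linarith : 0 ≤ Real.cosh z))]

lemma abs_deriv_cube_div_sinh_le {z : ℝ} (hz : 0 < z) :
    |(3 * z ^ 2 * Real.sinh z - z ^ 3 * Real.cosh z) / Real.sinh z ^ 2| ≤ 12 * halfTanh z := by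
  have hs := Real.sinh_pos_iff.2 hz
  have h1 := Real.self_le_sinh_iff.2 hz.le
  have h0 := Real.one_le_cosh z
  have hc := sq_div_two_add_le_cosh hz.le
  have h2 : z * Real.cosh z ≤ Real.sinh z * (1 + z) := by
    have e : Real.cosh z = Real.sinh z + Real.exp (-z) := by
      rw [Real.cosh_eq, Real.sinh_eq]; ring
    have : Real.exp (-z) ≤ 1 := Real.exp_le_one_iff.2 (by linarith)
    rw [e]; nlinarith
  have h3 : z ^ 2 * (4 + z) ≤ 12 * (Real.cosh z - 1) := by
    nlinarith [mul_nonneg (sq_nonneg z) (sq_nonneg (z - 4)), sq_nonneg z]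
  have h4 : |3 * z ^ 2 * Real.sinh z - z ^ 3 * Real.cosh z| ≤ z ^ 2 * (4 + z) * Real.sinh z := by
    have hz2 := sq_nonneg z
    have a1 : z ^ 3 * Real.cosh z ≤ z ^ 2 * (Real.sinh z * (1 + z)) := by
      calc _ = z ^ 2 * (z * Real.cosh z) := by ring
        _ ≤ _ := mul_le_mul_of_nonneg_left h2 hz2
    have a2 : 0 ≤ z ^ 3 * Real.cosh z := by positivity
    have a3 : 0 ≤ z ^ 2 * Real.sinh z := by positivity
    have a4 : 0 ≤ z ^ 3 * Real.sinh z := by positivity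
    rw [abs_le]; constructor <;> nlinarith
  unfold halfTanh
  rw [abs_div, abs_of_pos (pow_pos hs 2), mul_div_assoc', div_le_div_iff₀ (pow_pos hs 2) hs]
  calc _ ≤ z ^ 2 * (4 + z) * Real.sinh z * Real.sinh z := mul_le_mul_of_nonneg_right h4 hs.le
    _ ≤ 12 * (Real.cosh z - 1) * Real.sinh z * Real.sinh z := by gcongr
    _ = _ := by ring

lemma abs_sub_le_of_abs_deriv_le_halfTanh {G G' : ℝ → ℝ} {K : ℝ} (hK : 0 ≤ K)
    (hG : ∀ z, 0 < z → HasDerivAt G (G' z) z) (hb : ∀ z, 0 < z → |G' z| ≤ K * halfTanh z)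
    {z w : ℝ} (hz : 0 < z) (hw : 0 < w) :
    |G w - G z| ≤ K * (|w - z| * (halfTanh z + halfTanh w)) := by
  have h := (convex_uIcc z w).norm_image_sub_le_of_norm_hasDerivWithin_le
    (f := G) (f' := G') (C := K * (halfTanh z + halfTanh w)) (x := z) (y := w)
    (fun t ht => (hG t (lt_of_lt_of_le (lt_min hz hw) ht.1)).hasDerivWithinAt)
    (fun t ht => by
      have ht0 : 0 < t := lt_of_lt_of_le (lt_min hz hw) ht.1
      refine (hb t ht0).trans (mul_le_mul_of_nonneg_left ?_ hK)
      have p1 := halfTanh_pos hz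
      have p2 := halfTanh_pos hw
      rcases le_max_iff.1 ht.2 with h | h
      · linarith [halfTanh_mono ht0 h]
      · linarith [halfTanh_mono ht0 h]) left_mem_uIcc right_mem_uIcc
  simp only [Real.norm_eq_abs] at h
  calc _ ≤ _ := h
    _ = _ := by ring

lemma abs_div_sinh_sub_le {z w : ℝ} (hz : 0 < z) (hw : 0 < w) :
    |w / Real.sinh w - z / Real.sinh z| ≤ |w - z| * (halfTanh z + halfTanh w) := by
  have := abs_sub_le_of_abs_deriv_le_halfTanh (G := fun z => z / Real.sinh z)
    (G' := fun z => (Real.sinh z - z * Real.cosh z) / Real.sinh z ^ 2) (K := 1) zero_le_one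
    (fun z hz => by
      exact ((hasDerivAt_id z).div (Real.hasDerivAt_sinh z)
        (Real.sinh_pos_iff.2 hz).ne').congr_deriv (by simp))
    (fun z hz => by simpa using abs_deriv_div_sinh_le hz) hz hw
  simpa using this

lemma abs_cube_div_sinh_sub_le {z w : ℝ} (hz : 0 < z) (hw : 0 < w) :
    |w ^ 3 / Real.sinh w - z ^ 3 / Real.sinh z|
      ≤ 12 * (|w - z| * (halfTanh z + halfTanh w)) :=
  abs_sub_le_of_abs_deriv_le_halfTanh (G := fun z => z ^ 3 / Real.sinh z)
    (G' := fun z => (3 * z ^ 2 * Real.sinh z - z ^ 3 * Real.cosh z) / Real.sinh z ^ 2)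
    (by norm_num)
    (fun z hz => by
      exact ((hasDerivAt_pow 3 z).div (Real.hasDerivAt_sinh z)
        (Real.sinh_pos_iff.2 hz).ne').congr_deriv (by simp))
    (fun z hz => abs_deriv_cube_div_sinh_le hz) hz hw

/-- The scheme splits into a fitted second difference and two plain second differences. -/
lemma fitted_row_eq {γ q z w yL y yR gL g gR : ℝ} (hγ : 0 < γ) (hz : 0 < z) (hw : 0 < w) :
    γ / (1 / Real.tanh z - 1 / Real.sinh z + (1 / Real.tanh w - 1 / Real.sinh w)) *
      (((q + 1) * (1 / Real.sinh z) + 1 / Real.tanh z + (1 / Real.tanh w - 1 / Real.sinh w))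
          * (yL - y)
        - ((q + 1) * (1 / Real.sinh w) + 1 / Real.tanh w + (1 / Real.tanh z - 1 / Real.sinh z))
          * (y - yR)
        - (gL + q * g + gR) / γ *
          (1 / Real.tanh z - 1 / Real.sinh z + (1 / Real.tanh w - 1 / Real.sinh w)))
    = (q + 2) * (γ * ((yL - y) / Real.sinh z + (yR - y) / Real.sinh w)
        / (halfTanh z + halfTanh w) - g) + γ * (yL - 2 * y + yR) - (gL - 2 * g + gR) := by
  have e : ∀ z : ℝ, 0 < z → 1 / Real.tanh z = halfTanh z + 1 / Real.sinh z := by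
    intro z hz
    rw [Real.tanh_eq_sinh_div_cosh, halfTanh, one_div_div]
    ring
  rw [e z hz, e w hw]
  have hD : halfTanh z + halfTanh w ≠ 0 := (add_pos (halfTanh_pos hz) (halfTanh_pos hw)).ne'
  have h1 := (Real.sinh_pos_iff.2 hz).ne'
  have h2 := (Real.sinh_pos_iff.2 hw).ne'
  have h3 := hγ.ne'
  generalize halfTanh z = A at *
  generalize halfTanh w = B at *
  rw [show A + 1 / Real.sinh z - 1 / Real.sinh z + (B + 1 / Real.sinh w - 1 / Real.sinh w) = A + B
    by ring]
  field_simp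
  ring

lemma fitted_defect_le_of_taylor {γ β ε h H y y1 y2 y3 yL yR M : ℝ} (hβ : 0 < β)
    (hγ : β ^ 2 * ε ^ 2 = γ) (hh : 0 < h) (hH : 0 < H)
    (hL : |yL - y + h * y1 - h ^ 2 / 2 * y2 + h ^ 3 / 6 * y3| ≤ M * h ^ 4)
    (hR : |yR - y - H * y1 - H ^ 2 / 2 * y2 - H ^ 3 / 6 * y3| ≤ M * H ^ 4) :
    |γ * ((yL - y) / Real.sinh (β * h) + (yR - y) / Real.sinh (β * H))
        / (halfTanh (β * h) + halfTanh (β * H)) - ε ^ 2 * y2|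
      ≤ (γ * |y1| + 2 * ε ^ 2 * |y3|) * |H - h|
        + (γ * |y2| / 2 + 2 * ε ^ 2 * M) * (h ^ 2 + H ^ 2) := by
  have hγ0 : 0 ≤ γ := by rw [← hγ]; positivity
  have hM : 0 ≤ M := by
    have := (abs_nonneg _).trans hL
    exact nonneg_of_mul_nonneg_left this (by positivity)
  set rL := yL - y + h * y1 - h ^ 2 / 2 * y2 + h ^ 3 / 6 * y3 with hrL
  set rR := yR - y - H * y1 - H ^ 2 / 2 * y2 - H ^ 3 / 6 * y3 with hrR
  have eL : yL - y = rL - h * y1 + h ^ 2 / 2 * y2 - h ^ 3 / 6 * y3 := by rw [hrL]; ring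
  have eR : yR - y = rR + H * y1 + H ^ 2 / 2 * y2 + H ^ 3 / 6 * y3 := by rw [hrR]; ring
  rw [eL, eR]
  clear_value rL rR
  have hz : 0 < β * h := by positivity
  have hw : 0 < β * H := by positivity
  have n1 := abs_div_sinh_sub_le hz hw
  have n2 := abs_sq_div_sinh_sub_le hz
  have n2' := abs_sq_div_sinh_sub_le hw
  have n3 := abs_cube_div_sinh_sub_le hz hw
  have n4 := pow_four_div_sinh_le hz
  have n4' := pow_four_div_sinh_le hw
  have tz := halfTanh_pos hz
  have tw := halfTanh_pos hw
  have sz := Real.sinh_pos_iff.2 hz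
  have sw := Real.sinh_pos_iff.2 hw
  generalize Real.sinh (β * h) = S at *
  generalize Real.sinh (β * H) = R at *
  generalize halfTanh (β * h) = A at *
  generalize halfTanh (β * H) = B at *
  have hD : 0 < A + B := by positivity
  have edist : |β * H - β * h| = β * |H - h| := by
    rw [← mul_sub, abs_mul, abs_of_pos hβ]
  rw [edist] at n1 n3
  have hAB : h ^ 2 * A + H ^ 2 * B ≤ (h ^ 2 + H ^ 2) * (A + B) := by
    nlinarith [mul_nonneg (sq_nonneg h) tw.le, mul_nonneg (sq_nonneg H) tz.le]
  have t1 : |γ / β * y1 * (β * H / R - β * h / S)| ≤ γ * |y1| * |H - h| * (A + B) := by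
    rw [abs_mul, abs_mul, abs_div, abs_of_nonneg hγ0, abs_of_pos hβ]
    calc _ ≤ γ / β * |y1| * (β * |H - h| * (A + B)) := by gcongr
      _ = _ := by field_simp
  have t2 : |ε ^ 2 * y2 / 2 * (((β * h) ^ 2 / S - 2 * A) + ((β * H) ^ 2 / R - 2 * B))|
      ≤ γ * |y2| / 2 * (h ^ 2 + H ^ 2) * (A + B) := by
    rw [abs_mul, abs_div, abs_mul, abs_two, abs_of_nonneg (sq_nonneg ε)]
    calc _ ≤ ε ^ 2 * |y2| / 2 * ((β * h) ^ 2 * A + (β * H) ^ 2 * B) := by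
          gcongr
          exact (abs_add_le _ _).trans (add_le_add n2 n2')
      _ = γ * |y2| / 2 * (h ^ 2 * A + H ^ 2 * B) := by rw [← hγ]; ring
      _ ≤ γ * |y2| / 2 * ((h ^ 2 + H ^ 2) * (A + B)) := by gcongr
      _ = _ := by ring
  have t3 : |ε ^ 2 * y3 / (6 * β) * ((β * H) ^ 3 / R - (β * h) ^ 3 / S)|
      ≤ 2 * ε ^ 2 * |y3| * |H - h| * (A + B) := by
    rw [abs_mul, abs_div, abs_mul, abs_of_nonneg (sq_nonneg ε),
      abs_of_pos (by positivity : 0 < 6 * β)]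
    calc _ ≤ ε ^ 2 * |y3| / (6 * β) * (12 * (β * |H - h| * (A + B))) := by gcongr
      _ = _ := by field_simp; ring
  have t4 : |γ * (rL / S + rR / R)| ≤ 2 * ε ^ 2 * M * (h ^ 2 + H ^ 2) * (A + B) := by
    rw [abs_mul, abs_of_nonneg hγ0]
    calc _ ≤ γ * (|rL / S| + |rR / R|) := by gcongr; exact abs_add_le _ _
      _ = γ * (|rL| / S + |rR| / R) := by rw [abs_div, abs_div, abs_of_pos sz, abs_of_pos sw]
      _ ≤ γ * (M * h ^ 4 / S + M * H ^ 4 / R) := by gcongr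
      _ = ε ^ 2 * M / β ^ 2 * ((β * h) ^ 4 / S + (β * H) ^ 4 / R) := by
          rw [← hγ]; field_simp
      _ ≤ ε ^ 2 * M / β ^ 2 * (2 * ((β * h) ^ 2 * A) + 2 * ((β * H) ^ 2 * B)) := by gcongr
      _ = 2 * ε ^ 2 * M * (h ^ 2 * A + H ^ 2 * B) := by field_simp
      _ ≤ 2 * ε ^ 2 * M * ((h ^ 2 + H ^ 2) * (A + B)) := by gcongr
      _ = _ := by ring
  have key : γ * ((rL - h * y1 + h ^ 2 / 2 * y2 - h ^ 3 / 6 * y3) / S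
        + (rR + H * y1 + H ^ 2 / 2 * y2 + H ^ 3 / 6 * y3) / R) / (A + B) - ε ^ 2 * y2
      = (γ / β * y1 * (β * H / R - β * h / S)
        + ε ^ 2 * y2 / 2 * (((β * h) ^ 2 / S - 2 * A) + ((β * H) ^ 2 / R - 2 * B))
        + ε ^ 2 * y3 / (6 * β) * ((β * H) ^ 3 / R - (β * h) ^ 3 / S)
        + γ * (rL / S + rR / R)) / (A + B) := by
    rw [← hγ]
    field_simp
    ring
  rw [key, abs_div, abs_of_pos hD, div_le_iff₀ hD]
  have q1 := abs_add_three (γ / β * y1 * (β * H / R - β * h / S))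
    (ε ^ 2 * y2 / 2 * (((β * h) ^ 2 / S - 2 * A) + ((β * H) ^ 2 / R - 2 * B)))
    (ε ^ 2 * y3 / (6 * β) * ((β * H) ^ 3 / R - (β * h) ^ 3 / S))
  refine (abs_add_le _ _).trans ?_
  linarith

/-- Crude bound of the fitted second difference on steps that are not small compared with `ε`. -/
lemma fitted_defect_le_of_coarse {γ β h H y yL yR g c L B : ℝ} (hβ : 0 < β)
    (hγ : 0 ≤ γ) (hc : 0 < c) (hh : c ≤ β * h) (hH : c ≤ β * H) (hL0 : 0 ≤ L) (hB : 0 ≤ B)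
    (hL : |yL - y| ≤ L * h + B) (hR : |yR - y| ≤ L * H + B) :
    |γ * ((yL - y) / Real.sinh (β * h) + (yR - y) / Real.sinh (β * H))
        / (halfTanh (β * h) + halfTanh (β * H)) - g|
      ≤ γ * (L / β + B / c) / halfTanh c + |g| := by
  have tc := halfTanh_pos hc
  have side : ∀ h d : ℝ, c ≤ β * h → |d| ≤ L * h + B →
      |d / Real.sinh (β * h)| ≤ L / β + B / c := by
    intro h d hh hd
    have hz : 0 < β * h := hc.trans_le hh
    have hh0 : 0 < h := pos_of_mul_pos_right hz hβ.le
    have s1 : β * h ≤ Real.sinh (β * h) := Real.self_le_sinh_iff.2 hz.le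
    rw [abs_div, abs_of_pos (hz.trans_le s1)]
    calc |d| / Real.sinh (β * h) ≤ |d| / (β * h) := by gcongr
      _ ≤ (L * h + B) / (β * h) := by gcongr
      _ = L / β + B / (β * h) := by field_simp
      _ ≤ L / β + B / c := by gcongr
  have a1 := side h _ hh hL
  have a2 := side H _ hH hR
  have d1 := halfTanh_mono hc hh
  have d2 := halfTanh_mono hc hH
  refine (abs_sub _ _).trans ?_
  gcongr
  have hD : 0 < halfTanh (β * h) + halfTanh (β * H) := by linarith
  have hX : 0 ≤ L / β + B / c := by positivity
  rw [abs_div, abs_mul, abs_of_nonneg hγ, abs_of_pos hD]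
  calc _ ≤ γ * ((L / β + B / c) + (L / β + B / c)) / (halfTanh c + halfTanh c) := by
        gcongr
        exact (abs_add_le _ _).trans (add_le_add a1 a2)
    _ = _ := by field_simp

lemma abs_second_diff_le {A B xL x xR K : ℝ} {u u1 u2 : ℝ → ℝ}
    (hu : ∀ t ∈ Icc A B, HasDerivWithinAt u (u1 t) (Icc A B) t)
    (hu1 : ∀ t ∈ Icc A B, HasDerivWithinAt u1 (u2 t) (Icc A B) t)
    (hL : A ≤ xL) (hLx : xL ≤ x) (hxR : x ≤ xR) (hR : xR ≤ B)
    (hK : ∀ t ∈ Icc xL xR, |u2 t| ≤ K) :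
    |u xL - 2 * u x + u xR|
      ≤ |u1 x| * |(xR - x) - (x - xL)| + K / 2 * ((x - xL) ^ 2 + (xR - x) ^ 2) := by
  have hx : x ∈ Icc A B := ⟨by linarith, by linarith⟩
  have a1 := abs_taylor_two_le hu hu1 hx (x' := xL) ⟨by linarith, by linarith⟩ (K := K)
    (by
      intro t ht
      rw [uIcc_of_ge hLx] at ht
      exact hK t ⟨ht.1, ht.2.trans hxR⟩)
  have a2 := abs_taylor_two_le hu hu1 hx (x' := xR) ⟨by linarith, by linarith⟩ (K := K)
    (by
      intro t ht
      rw [uIcc_of_le hxR] at ht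
      exact hK t ⟨hLx.trans ht.1, ht.2⟩)
  have e : u xL - 2 * u x + u xR = (u xL - u x - (xL - x) * u1 x)
      + (u xR - u x - (xR - x) * u1 x) + u1 x * ((xR - x) - (x - xL)) := by ring
  rw [e, ← abs_mul]
  refine (abs_add_three _ _ _).trans ?_
  have : (xL - x) ^ 2 = (x - xL) ^ 2 := by ring
  rw [this] at a1
  linarith

/-- The two boundary-layer exponentials. -/
noncomputable def layer (c ε x : ℝ) : ℝ :=
  Real.exp (-(c * x / ε)) + Real.exp (-(c * (1 - x) / ε))

/-- A priori information on the solution `y` of `ε² y'' = g`, with reduced solution `v`. -/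
structure HasLayerBounds (C c ε : ℝ) (y y1 g g1 g2 v v1 v2 : ℝ → ℝ) : Prop where
  hy : ∀ t ∈ Icc (0:ℝ) 1, HasDerivWithinAt y (y1 t) (Icc 0 1) t
  hy1 : ∀ t ∈ Icc (0:ℝ) 1, HasDerivWithinAt y1 (g t / ε ^ 2) (Icc 0 1) t
  hg : ∀ t ∈ Icc (0:ℝ) 1, HasDerivWithinAt g (g1 t) (Icc 0 1) t
  hg1 : ∀ t ∈ Icc (0:ℝ) 1, HasDerivWithinAt g1 (g2 t) (Icc 0 1) t
  hv : ∀ t ∈ Icc (0:ℝ) 1, HasDerivWithinAt v (v1 t) (Icc 0 1) t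
  hv1 : ∀ t ∈ Icc (0:ℝ) 1, HasDerivWithinAt v1 (v2 t) (Icc 0 1) t
  v1_le : ∀ t ∈ Icc (0:ℝ) 1, |v1 t| ≤ C
  v2_le : ∀ t ∈ Icc (0:ℝ) 1, |v2 t| ≤ C
  sub_le : ∀ t ∈ Icc (0:ℝ) 1, |y t - v t| ≤ C * (ε ^ 2 + layer c ε t)
  y1_le : ∀ t ∈ Icc (0:ℝ) 1, |y1 t| ≤ C * (1 + layer c ε t / ε)
  g_le : ∀ t ∈ Icc (0:ℝ) 1, |g t| ≤ C * (ε ^ 2 + layer c ε t)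
  g1_le : ∀ t ∈ Icc (0:ℝ) 1, |g1 t| ≤ C * (1 + layer c ε t / ε)
  g2_le : ∀ t ∈ Icc (0:ℝ) 1, |g2 t| ≤ C * (1 + layer c ε t / ε ^ 2)

/-- The residual of the exact solution in one row of the scheme. -/
noncomputable def rowResidual (γ q β : ℝ) (y g : ℝ → ℝ) (xL x xR : ℝ) : ℝ :=
  (q + 2) * (γ * ((y xL - y x) / Real.sinh (β * (x - xL)) + (y xR - y x) / Real.sinh (β * (xR - x)))
    / (halfTanh (β * (x - xL)) + halfTanh (β * (xR - x))) - g x)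
  + γ * (y xL - 2 * y x + y xR) - (g xL - 2 * g x + g xR)

lemma abs_rowResidual_le {γ q β T P Q : ℝ} {y g : ℝ → ℝ} {xL x xR : ℝ} (hγ : 0 ≤ γ) (hq : 0 ≤ q)
    (hT : |γ * ((y xL - y x) / Real.sinh (β * (x - xL)) + (y xR - y x) / Real.sinh (β * (xR - x)))
      / (halfTanh (β * (x - xL)) + halfTanh (β * (xR - x))) - g x| ≤ T)
    (hP : |y xL - 2 * y x + y xR| ≤ P) (hQ : |g xL - 2 * g x + g xR| ≤ Q) :
    |rowResidual γ q β y g xL x xR| ≤ (q + 2) * T + γ * P + Q := by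
  unfold rowResidual
  refine (abs_sub _ _).trans (add_le_add ((abs_add_le _ _).trans (add_le_add ?_ ?_)) hQ)
  · rw [abs_mul, abs_of_nonneg (by linarith)]
    gcongr
  · rw [abs_mul, abs_of_nonneg hγ]
    gcongr

lemma HasLayerBounds.rowResidual_le_of_fine {C c ε γ q β η M xL x xR : ℝ}
    {y y1 g g1 g2 v v1 v2 : ℝ → ℝ} (hS : HasLayerBounds C c ε y y1 g g1 g2 v v1 v2)
    (hC : 0 ≤ C) (hβ : 0 < β) (hε : 0 < ε) (hγ : β ^ 2 * ε ^ 2 = γ) (hq : 0 ≤ q)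
    (hL : 0 ≤ xL) (hLx : xL < x) (hxR : x < xR) (hR : xR ≤ 1)
    (hM : ∀ t ∈ Icc xL xR, layer c ε t ≤ M)
    (h1 : (x - xL) ^ 2 + (xR - x) ^ 2 ≤ η) (h2 : |(xR - x) - (x - xL)| ≤ η)
    (h3 : M / ε * |(xR - x) - (x - xL)| ≤ η)
    (h4 : M / ε ^ 2 * ((x - xL) ^ 2 + (xR - x) ^ 2) ≤ η) :
    |rowResidual γ q β y g xL x xR| ≤ ((q + 2) * (4 * γ * C + 8 * C) + 4 * γ * C + 4 * C) * η := by
  have hγ0 : 0 ≤ γ := by rw [← hγ]; positivity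
  have hx : x ∈ Icc (0:ℝ) 1 := ⟨by linarith, by linarith⟩
  have hsub : ∀ t ∈ Icc xL xR, t ∈ Icc (0:ℝ) 1 := fun t ht => ⟨hL.trans ht.1, ht.2.trans hR⟩
  have hxm : x ∈ Icc xL xR := ⟨hLx.le, hxR.le⟩
  have hη : 0 ≤ η := (abs_nonneg _).trans h2
  have hy4 : ∀ t ∈ Icc xL xR, |g2 t| ≤ C * (1 + M / ε ^ 2) := fun t ht =>
    (hS.g2_le t (hsub t ht)).trans (by gcongr; exact hM t ht)
  have hC1 : C * (1 + M / ε) * |(xR - x) - (x - xL)| ≤ 2 * C * η := by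
    nlinarith
  have hC2 : C * (1 + M / ε ^ 2) * ((x - xL) ^ 2 + (xR - x) ^ 2) ≤ 2 * C * η := by
    nlinarith
  have by1 : |y1 x| ≤ C * (1 + M / ε) :=
    (hS.y1_le x hx).trans (by gcongr; exact hM x hxm)
  have bg1 : |g1 x| ≤ C * (1 + M / ε) :=
    (hS.g1_le x hx).trans (by gcongr; exact hM x hxm)
  have bg : ∀ t ∈ Icc xL xR, |g t / ε ^ 2| ≤ C * (1 + M / ε ^ 2) := by
    intro t ht
    rw [abs_div, abs_of_pos (pow_pos hε 2), div_le_iff₀ (pow_pos hε 2)]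
    refine (hS.g_le t (hsub t ht)).trans ?_
    calc _ ≤ C * (ε ^ 2 + M) := by gcongr; exact hM t ht
      _ = _ := by field_simp
  have P := abs_second_diff_le hS.hy hS.hy1 hL hLx.le hxR.le hR bg
  have Q := abs_second_diff_le hS.hg hS.hg1 hL hLx.le hxR.le hR hy4
  have hy2 : ∀ t ∈ Icc (0:ℝ) 1, HasDerivWithinAt (fun t => g t / ε ^ 2) (g1 t / ε ^ 2) (Icc 0 1) t :=
    fun t ht => (hS.hg t ht).div_const _
  have hy3 : ∀ t ∈ Icc (0:ℝ) 1, HasDerivWithinAt (fun t => g1 t / ε ^ 2) (g2 t / ε ^ 2) (Icc 0 1) t :=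
    fun t ht => (hS.hg1 t ht).div_const _
  have hb4 : ∀ t ∈ Icc xL xR, |g2 t / ε ^ 2| ≤ C * (1 + M / ε ^ 2) / ε ^ 2 := by
    intro t ht
    rw [abs_div, abs_of_pos (pow_pos hε 2)]
    gcongr
    exact hy4 t ht
  have tL := abs_taylor_four_le hS.hy hS.hy1 hy2 hy3 hx (x' := xL) (hsub _ ⟨le_rfl, by linarith⟩)
    (K := C * (1 + M / ε ^ 2) / ε ^ 2) (by
      intro t ht
      rw [uIcc_of_ge hLx.le] at ht
      exact hb4 t ⟨ht.1, ht.2.trans hxR.le⟩)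
  have tR := abs_taylor_four_le hS.hy hS.hy1 hy2 hy3 hx (x' := xR) (hsub _ ⟨by linarith, le_rfl⟩)
    (K := C * (1 + M / ε ^ 2) / ε ^ 2) (by
      intro t ht
      rw [uIcc_of_le hxR.le] at ht
      exact hb4 t ⟨hLx.le.trans ht.1, ht.2⟩)
  have T := fitted_defect_le_of_taylor (γ := γ) (h := x - xL) (H := xR - x) (y := y x)
    (y1 := y1 x) (y2 := g x / ε ^ 2) (y3 := g1 x / ε ^ 2) (yL := y xL) (yR := y xR) hβ hγ
    (by linarith) (by linarith) (M := C * (1 + M / ε ^ 2) / ε ^ 2 / 24)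
    (by
      refine le_trans (le_of_eq ?_) (tL.trans (le_of_eq ?_))
      · congr 1; ring
      · ring)
    (by
      refine le_trans (le_of_eq ?_) (tR.trans (le_of_eq ?_))
      · congr 1
      · ring)
  rw [mul_div_cancel₀ _ (pow_pos hε 2).ne'] at T
  refine (abs_rowResidual_le hγ0 hq T P Q).trans ?_
  have e3 : 2 * ε ^ 2 * |g1 x / ε ^ 2| = 2 * |g1 x| := by
    rw [abs_div, abs_of_pos (pow_pos hε 2)]; field_simp
  have e4 : 2 * ε ^ 2 * (C * (1 + M / ε ^ 2) / ε ^ 2 / 24) = C * (1 + M / ε ^ 2) / 12 := by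
    field_simp; ring
  rw [e3, e4]
  have bgx := bg x hxm
  set D := |(xR - x) - (x - xL)| with hD
  set S := (x - xL) ^ 2 + (xR - x) ^ 2 with hSdef
  have hD0 : 0 ≤ D := abs_nonneg _
  have hS0 : 0 ≤ S := by positivity
  have z1 : |y1 x| * D ≤ 2 * C * η := (mul_le_mul_of_nonneg_right by1 hD0).trans hC1
  have z2 : |g1 x| * D ≤ 2 * C * η := (mul_le_mul_of_nonneg_right bg1 hD0).trans hC1
  have z3 : |g x / ε ^ 2| * S ≤ 2 * C * η := (mul_le_mul_of_nonneg_right bgx hS0).trans hC2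
  have hCη : 0 ≤ C * η := mul_nonneg hC hη
  generalize C * (1 + M / ε ^ 2) = K at *
  have w1 : (γ * |y1 x| + 2 * |g1 x|) * D + (γ * |g x / ε ^ 2| / 2 + K / 12) * S
      ≤ (4 * γ * C + 8 * C) * η := by
    have := mul_le_mul_of_nonneg_left z1 hγ0
    have := mul_le_mul_of_nonneg_left z3 hγ0
    have := mul_nonneg hγ0 hCη
    linarith
  have w2 : |y1 x| * D + K / 2 * S ≤ 4 * C * η := by linarith
  have w3 : |g1 x| * D + K / 2 * S ≤ 4 * C * η := by linarith
  calc _ ≤ (q + 2) * ((4 * γ * C + 8 * C) * η) + γ * (4 * C * η) + 4 * C * η := by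
        gcongr
    _ = _ := by ring

lemma HasLayerBounds.rowResidual_le_of_coarse {C c ε γ q β η M xL x xR b : ℝ}
    {y y1 g g1 g2 v v1 v2 : ℝ → ℝ} (hS : HasLayerBounds C c ε y y1 g g1 g2 v v1 v2)
    (hC : 0 ≤ C) (hγ : 0 < γ) (hε : 0 < ε) (hε1 : ε ≤ 1) (hβ : β = √γ / ε) (hq : 0 ≤ q)
    (hL : 0 ≤ xL) (hLx : xL < x) (hxR : x < xR) (hR : xR ≤ 1)
    (hM : ∀ t ∈ Icc xL xR, layer c ε t ≤ M)
    (h1 : (x - xL) ^ 2 + (xR - x) ^ 2 ≤ η) (h2 : |(xR - x) - (x - xL)| ≤ η)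
    (h3 : ε ≤ η) (h4 : M ≤ η) (hb : 0 < b) (h5 : b * ε ≤ x - xL) (h6 : b * ε ≤ xR - x) :
    |rowResidual γ q β y g xL x xR| ≤
      ((q + 2) * (γ * (C / √γ + 4 * C / (√γ * b)) / halfTanh (√γ * b) + 2 * C)
        + γ * (10 * C) + 8 * C) * η := by
  have hsγ : 0 < √γ := Real.sqrt_pos.2 hγ
  have hβ0 : 0 < β := by rw [hβ]; positivity
  have hη : 0 ≤ η := (abs_nonneg _).trans h2
  have hsub : ∀ t ∈ Icc xL xR, t ∈ Icc (0:ℝ) 1 := fun t ht => ⟨hL.trans ht.1, ht.2.trans hR⟩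
  have mL : xL ∈ Icc xL xR := ⟨le_rfl, by linarith⟩
  have mx : x ∈ Icc xL xR := ⟨hLx.le, hxR.le⟩
  have mR : xR ∈ Icc xL xR := ⟨by linarith, le_rfl⟩
  have hεη : ε ^ 2 ≤ η := by nlinarith
  have bs : ∀ t ∈ Icc xL xR, C * (ε ^ 2 + layer c ε t) ≤ 2 * C * η := by
    intro t ht
    have := hM t ht
    nlinarith
  have bg : ∀ t ∈ Icc xL xR, |g t| ≤ 2 * C * η := fun t ht =>
    (hS.g_le t (hsub t ht)).trans (bs t ht)
  have bv : ∀ t ∈ Icc xL xR, |y t - v t| ≤ 2 * C * η := fun t ht =>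
    (hS.sub_le t (hsub t ht)).trans (bs t ht)
  have lip : ∀ s ∈ Icc xL xR, |v s - v x| ≤ C * |s - x| := by
    intro s hs
    have := (convex_Icc (0:ℝ) 1).norm_image_sub_le_of_norm_hasDerivWithin_le
      (fun t ht => hS.hv t ht) (fun t ht => hS.v1_le t ht) (hsub x mx) (hsub s hs)
    simpa [Real.norm_eq_abs] using this
  have bdiff : ∀ s ∈ Icc xL xR, |y s - y x| ≤ C * |s - x| + 4 * C * η := by
    intro s hs
    have e : y s - y x = (y s - v s) + (v s - v x) - (y x - v x) := by ring
    rw [e]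
    refine (abs_sub _ _).trans ?_
    have := abs_add_le (y s - v s) (v s - v x)
    linarith [bv s hs, bv x mx, lip s hs]
  have dL := bdiff xL mL
  have dR := bdiff xR mR
  rw [abs_sub_comm, abs_sub_comm xL, abs_of_pos (sub_pos.2 hLx), abs_sub_comm] at dL
  rw [abs_of_pos (sub_pos.2 hxR)] at dR
  have hβε : β * ε = √γ := by rw [hβ]; field_simp
  have T := fitted_defect_le_of_coarse (g := g x) (c := √γ * b) (h := x - xL) (H := xR - x)
    hβ0 hγ.le (by positivity)
    (by
      calc _ = β * (b * ε) := by rw [← hβε]; ring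
        _ ≤ _ := by gcongr)
    (by
      calc _ = β * (b * ε) := by rw [← hβε]; ring
        _ ≤ _ := by gcongr) hC (by positivity) dL dR
  have T' : γ * (C / β + 4 * C * η / (√γ * b)) / halfTanh (√γ * b) + |g x|
      ≤ (γ * (C / √γ + 4 * C / (√γ * b)) / halfTanh (√γ * b) + 2 * C) * η := by
    have tp : 0 < halfTanh (√γ * b) := halfTanh_pos (by positivity)
    have : C / β ≤ C / √γ * η := by
      calc C / β = C / √γ * ε := by rw [hβ]; field_simp
        _ ≤ _ := by gcongr
    calc _ ≤ γ * (C / √γ * η + 4 * C * η / (√γ * b)) / halfTanh (√γ * b) + 2 * C * η := by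
          gcongr
          exact bg x mx
      _ = _ := by ring
  have V := abs_second_diff_le hS.hv hS.hv1 hL hLx.le hxR.le hR
    (fun t ht => hS.v2_le t (hsub t ht))
  have P : |y xL - 2 * y x + y xR| ≤ 10 * C * η := by
    have e : y xL - 2 * y x + y xR = (v xL - 2 * v x + v xR) + ((y xL - v xL)
      + (-2 * (y x - v x)) + (y xR - v xR)) := by ring
    rw [e]
    have a1 := abs_add_le (v xL - 2 * v x + v xR) ((y xL - v xL)
      + (-2 * (y x - v x)) + (y xR - v xR))
    have a2 := abs_add_three (y xL - v xL) (-2 * (y x - v x)) (y xR - v xR)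
    rw [abs_mul, abs_neg, abs_two] at a2
    have a3 : |v1 x| * |(xR - x) - (x - xL)| ≤ C * η :=
      mul_le_mul (hS.v1_le x (hsub x mx)) h2 (abs_nonneg _) hC
    have a4 := mul_le_mul_of_nonneg_left h1 hC
    have := bv xL mL
    have := bv x mx
    have := bv xR mR
    have := mul_nonneg hC hη
    linarith
  have Q : |g xL - 2 * g x + g xR| ≤ 8 * C * η := by
    have a2 := abs_add_three (g xL) (-2 * g x) (g xR)
    rw [abs_mul, abs_neg, abs_two] at a2
    have e : g xL - 2 * g x + g xR = g xL + -2 * g x + g xR := by ring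
    rw [e]
    linarith [bg xL mL, bg x mx, bg xR mR]
  refine (abs_rowResidual_le hγ.le hq (T.trans T') P Q).trans (le_of_eq (by ring))

/-- First and second derivatives of the reaction term on the strip `[0, 1] × ℝ`. -/
structure IsReaction (m γ : ℝ) (f : ℝ → ℝ → ℝ) (Df : ℝ × ℝ → (ℝ × ℝ →L[ℝ] ℝ))
    (DDf : ℝ × ℝ → (ℝ × ℝ →L[ℝ] (ℝ × ℝ →L[ℝ] ℝ))) : Prop where
  hasFDeriv : ∀ x ∈ Icc (0:ℝ) 1, ∀ y,
    HasFDerivWithinAt (Function.uncurry f) (Df (x, y)) (Icc 0 1 ×ˢ univ) (x, y)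
  hasFDeriv' : ∀ x ∈ Icc (0:ℝ) 1, ∀ y,
    HasFDerivWithinAt Df (DDf (x, y)) (Icc 0 1 ×ˢ univ) (x, y)
  bounded : ∀ R, ∃ K > 0, ∀ x ∈ Icc (0:ℝ) 1, ∀ y, |y| ≤ R →
    |f x y| ≤ K ∧ ‖Df (x, y)‖ ≤ K ∧ ‖DDf (x, y)‖ ≤ K
  mono : ∀ x ∈ Icc (0:ℝ) 1, ∀ y z, ∃ b, m ≤ b ∧ b ≤ γ ∧ f x y - f x z = b * (y - z)
  le_partial : ∀ x ∈ Icc (0:ℝ) 1, ∀ y, m ≤ Df (x, y) (0, 1)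

lemma exists_isReaction {k : ℕ} (hk : 2 ≤ k) {m γ : ℝ} {f : ℝ → ℝ → ℝ}
    (hf : ContDiffOn ℝ k (Function.uncurry f) (Icc 0 1 ×ˢ univ))
    (hfy : ∀ x y : ℝ, x ∈ Icc (0:ℝ) 1 → m ≤ deriv (f x) y ∧ deriv (f x) y ≤ γ) :
    ∃ Df DDf, IsReaction m γ f Df DDf := by
  set S : Set (ℝ × ℝ) := Icc 0 1 ×ˢ univ with hS
  have hu : UniqueDiffOn ℝ S := (uniqueDiffOn_Icc zero_lt_one).prod uniqueDiffOn_univ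
  have h2 : ContDiffOn ℝ 2 (Function.uncurry f) S := hf.of_le (by exact_mod_cast hk)
  have h1 : ContDiffOn ℝ 1 (fderivWithin ℝ (Function.uncurry f) S) S :=
    h2.fderivWithin hu (by norm_num)
  have h0 : ContDiffOn ℝ 0 (fderivWithin ℝ (fderivWithin ℝ (Function.uncurry f) S) S) S :=
    h1.fderivWithin hu (by norm_num)
  have hmem : ∀ x ∈ Icc (0:ℝ) 1, ∀ y : ℝ, (x, y) ∈ S := fun x hx y => ⟨hx, mem_univ _⟩
  have hD : ∀ x ∈ Icc (0:ℝ) 1, ∀ y, HasFDerivWithinAt (Function.uncurry f)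
      (fderivWithin ℝ (Function.uncurry f) S (x, y)) S (x, y) := fun x hx y =>
    ((h2.differentiableOn (by norm_num)) _ (hmem x hx y)).hasFDerivWithinAt
  have hpart : ∀ x ∈ Icc (0:ℝ) 1, ∀ y,
      HasDerivAt (f x) (fderivWithin ℝ (Function.uncurry f) S (x, y) (0, 1)) y := by
    intro x hx y
    have hc : HasDerivWithinAt (fun y : ℝ => (x, y)) ((0:ℝ), (1:ℝ)) univ y :=
      ((hasDerivAt_const y x).prodMk (hasDerivAt_id y)).hasDerivWithinAt
    have := (hD x hx y).comp_hasDerivWithinAt y hc (fun t _ => hmem x hx t)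
    exact hasDerivWithinAt_univ.1 this
  refine ⟨fderivWithin ℝ (Function.uncurry f) S,
    fderivWithin ℝ (fderivWithin ℝ (Function.uncurry f) S) S, hD, ?_, ?_, ?_, ?_⟩
  · exact fun x hx y =>
      ((h1.differentiableOn (by norm_num)) _ (hmem x hx y)).hasFDerivWithinAt
  · intro R
    have hcomp : IsCompact (Icc (0:ℝ) 1 ×ˢ Icc (-R) R) := isCompact_Icc.prod isCompact_Icc
    have hsub : Icc (0:ℝ) 1 ×ˢ Icc (-R) R ⊆ S := prod_mono_right (subset_univ _)
    obtain ⟨K0, hK0⟩ := hcomp.exists_bound_of_continuousOn (h2.continuousOn.mono hsub)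
    obtain ⟨K1, hK1⟩ := hcomp.exists_bound_of_continuousOn (h1.continuousOn.mono hsub)
    obtain ⟨K2, hK2⟩ := hcomp.exists_bound_of_continuousOn 
      (f := fderivWithin ℝ (fderivWithin ℝ (Function.uncurry f) S) S) (h0.continuousOn.mono hsub)
    refine ⟨max 1 (max K0 (max K1 K2)), by positivity, fun x hx y hy => ?_⟩
    have hxy : (x, y) ∈ Icc (0:ℝ) 1 ×ˢ Icc (-R) R := ⟨hx, abs_le.1 hy⟩
    refine ⟨(hK0 _ hxy).trans ?_, (hK1 _ hxy).trans ?_, (hK2 _ hxy).trans ?_⟩ <;> simp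
  · intro x hx y z
    have key : ∀ y z : ℝ, z < y → ∃ b, m ≤ b ∧ b ≤ γ ∧ f x y - f x z = b * (y - z) := by
      intro y z hzy
      obtain ⟨c, -, hc⟩ := exists_hasDerivAt_eq_slope (f x) _ hzy
        (fun t _ => (hpart x hx t).continuousAt.continuousWithinAt) (fun t _ => hpart x hx t)
      have hd := hfy x c hx
      rw [(hpart x hx c).deriv] at hd
      refine ⟨_, hd.1, hd.2, ?_⟩
      rw [hc, div_mul_cancel₀ _ (sub_ne_zero.2 hzy.ne')]
    rcases lt_trichotomy z y with h | h | h
    · exact key y z h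
    · obtain ⟨b, h1, h2, -⟩ := key (y + 1) y (by linarith)
      exact ⟨b, h1, h2, by rw [h]; simp⟩
    · obtain ⟨b, h1, h2, h3⟩ := key z y h
      exact ⟨b, h1, h2, by linarith⟩
  · intro x hx y
    rw [← (hpart x hx y).deriv]
    exact (hfy x y hx).1

namespace IsReaction

variable {m γ : ℝ} {f : ℝ → ℝ → ℝ} {Df : ℝ × ℝ → (ℝ × ℝ →L[ℝ] ℝ)}
  {DDf : ℝ × ℝ → (ℝ × ℝ →L[ℝ] (ℝ × ℝ →L[ℝ] ℝ))}

lemma hasDerivWithinAt_comp (hF : IsReaction m γ f Df DDf) {y : ℝ → ℝ} {y' t : ℝ}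
    (ht : t ∈ Icc (0:ℝ) 1) (hy : HasDerivWithinAt y y' (Icc 0 1) t) :
    HasDerivWithinAt (fun t => f t (y t)) (Df (t, y t) (1, y')) (Icc 0 1) t := by
  have hc : HasDerivWithinAt (fun t : ℝ => (t, y t)) ((1:ℝ), y') (Icc 0 1) t :=
    (hasDerivWithinAt_id t _).prodMk hy
  have hmaps : MapsTo (fun t : ℝ => (t, y t)) (Icc 0 1) (Icc 0 1 ×ˢ univ) :=
    fun s hs => ⟨hs, mem_univ _⟩
  exact (hF.hasFDeriv t ht (y t)).comp_hasDerivWithinAt t hc hmaps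

lemma hasDerivWithinAt_fderiv_comp (hF : IsReaction m γ f Df DDf) {y : ℝ → ℝ} {y' t : ℝ}
    (ht : t ∈ Icc (0:ℝ) 1) (hy : HasDerivWithinAt y y' (Icc 0 1) t) :
    HasDerivWithinAt (fun t => Df (t, y t)) (DDf (t, y t) (1, y')) (Icc 0 1) t := by
  have hc : HasDerivWithinAt (fun t : ℝ => (t, y t)) ((1:ℝ), y') (Icc 0 1) t :=
    (hasDerivWithinAt_id t _).prodMk hy
  have hmaps : MapsTo (fun t : ℝ => (t, y t)) (Icc 0 1) (Icc 0 1 ×ˢ univ) :=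
    fun s hs => ⟨hs, mem_univ _⟩
  exact (hF.hasFDeriv' t ht (y t)).comp_hasDerivWithinAt t hc hmaps

lemma norm_one_prod_le (d : ℝ) : ‖((1:ℝ), d)‖ ≤ 1 + |d| := by
  rw [Prod.norm_mk]
  simp only [norm_one, Real.norm_eq_abs]
  exact max_le (by linarith [abs_nonneg d]) (by linarith)

lemma abs_apply_le (L : ℝ × ℝ →L[ℝ] ℝ) {z : ℝ × ℝ} (hz : ‖z‖ = 1) : |L z| ≤ ‖L‖ := by
  simpa [hz] using L.le_opNorm z

lemma mul_sub_le (hF : IsReaction m γ f Df DDf) {x y z : ℝ} (hx : x ∈ Icc (0:ℝ) 1) (h : z ≤ y) :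
    m * (y - z) ≤ f x y - f x z := by
  obtain ⟨b, hb, -, e⟩ := hF.mono x hx y z
  rw [e]
  exact mul_le_mul_of_nonneg_right hb (sub_nonneg.2 h)

lemma mul_abs_sub_le (hF : IsReaction m γ f Df DDf) (hm : 0 < m) {x : ℝ} (y z : ℝ)
    (hx : x ∈ Icc (0:ℝ) 1) : m * |y - z| ≤ |f x y - f x z| := by
  obtain ⟨b, hb, -, e⟩ := hF.mono x hx y z
  rw [e, abs_mul, abs_of_pos (hm.trans_le hb)]
  exact mul_le_mul_of_nonneg_right hb (abs_nonneg _)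

lemma abs_sub_le_mul (hF : IsReaction m γ f Df DDf) (hm : 0 < m) {x : ℝ} (y z : ℝ)
    (hx : x ∈ Icc (0:ℝ) 1) : |f x y - f x z| ≤ γ * |y - z| := by
  obtain ⟨b, hb, hb', e⟩ := hF.mono x hx y z
  rw [e, abs_mul, abs_of_pos (hm.trans_le hb)]
  exact mul_le_mul_of_nonneg_right hb' (abs_nonneg _)

/-- The reduced equation `f(x, v) = 0` has a root for each `x`, bounded independently of `x`. -/
lemma exists_root (hF : IsReaction m γ f Df DDf) (hm : 0 < m) {K x : ℝ} (hx : x ∈ Icc (0:ℝ) 1)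
    (hK : |f x 0| ≤ K) : ∃ v, f x v = 0 ∧ |v| ≤ K / m := by
  have hR : 0 ≤ K / m := div_nonneg ((abs_nonneg _).trans hK) hm.le
  have hmR : m * (K / m) = K := by field_simp
  have hK' := abs_le.1 hK
  have h1 := hF.mul_sub_le hx hR
  have h2 := hF.mul_sub_le hx (neg_nonpos.2 hR)
  have hcont : ContinuousOn (f x) (Icc (-(K / m)) (K / m)) := by
    have hlip : LipschitzWith γ.toNNReal (f x) := by
      refine LipschitzWith.of_dist_le_mul fun y z => ?_
      rw [Real.dist_eq, Real.dist_eq]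
      refine (hF.abs_sub_le_mul hm y z hx).trans ?_
      gcongr
      exact Real.le_coe_toNNReal γ
    exact hlip.continuous.continuousOn
  have := intermediate_value_Icc (by linarith) hcont
  obtain ⟨v, hv, hv0⟩ := this (show (0:ℝ) ∈ Icc (f x (-(K / m))) (f x (K / m)) from
    ⟨by linarith, by linarith⟩)
  exact ⟨v, hv0, abs_le.2 hv⟩

lemma lipschitz_root (hF : IsReaction m γ f Df DDf) (hm : 0 < m) {R K : ℝ}
    (hK : ∀ x ∈ Icc (0:ℝ) 1, ∀ y, |y| ≤ R → ‖Df (x, y)‖ ≤ K)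
    {v : ℝ → ℝ} (hv : ∀ x ∈ Icc (0:ℝ) 1, f x (v x) = 0)
    (hvR : ∀ x ∈ Icc (0:ℝ) 1, |v x| ≤ R) {x x' : ℝ} (hx : x ∈ Icc (0:ℝ) 1)
    (hx' : x' ∈ Icc (0:ℝ) 1) : |v x' - v x| ≤ K / m * |x' - x| := by
  have h1 := hF.mul_abs_sub_le hm (v x') (v x) hx'
  have h2 := (convex_Icc (0:ℝ) 1).norm_image_sub_le_of_norm_hasDerivWithin_le
    (f := fun t => f t (v x)) (C := K)
    (fun t ht => hF.hasDerivWithinAt_comp ht (hasDerivWithinAt_const t _ (v x)))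
    (fun t ht => by
      refine (abs_apply_le _ (by simp)).trans ?_
      exact hK t ht _ (hvR x hx)) hx hx'
  simp only [Real.norm_eq_abs, hv x hx, sub_zero] at h2
  rw [hv x' hx', zero_sub, abs_neg] at h1
  rw [div_mul_eq_mul_div, le_div_iff₀ hm]
  linarith

lemma hasDerivWithinAt_root (hF : IsReaction m γ f Df DDf) (hm : 0 < m) {R K : ℝ}
    (hK : ∀ x ∈ Icc (0:ℝ) 1, ∀ y, |y| ≤ R → ‖Df (x, y)‖ ≤ K)
    {v : ℝ → ℝ} (hv : ∀ x ∈ Icc (0:ℝ) 1, f x (v x) = 0)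
    (hvR : ∀ x ∈ Icc (0:ℝ) 1, |v x| ≤ R) {x : ℝ} (hx : x ∈ Icc (0:ℝ) 1) :
    HasDerivWithinAt v (-(Df (x, v x) (1, 0)) / Df (x, v x) (0, 1)) (Icc 0 1) x := by
  have hlip := fun x' hx' => hF.lipschitz_root hm hK hv hvR hx (x' := x') hx'
  have hB : 0 < Df (x, v x) (0, 1) := hm.trans_le (hF.le_partial x hx (v x))
  have hbig : (fun x' => (x', v x') - (x, v x)) =O[nhdsWithin x (Icc 0 1)] fun x' => x' - x := by
    refine Asymptotics.IsBigO.of_bound (max 1 (K / m)) ?_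
    filter_upwards [self_mem_nhdsWithin] with x' hx'
    rw [Prod.mk_sub_mk, Prod.norm_mk, Real.norm_eq_abs, Real.norm_eq_abs]
    refine max_le ?_ ((hlip x' hx').trans ?_)
    · exact le_mul_of_one_le_left (abs_nonneg _) (le_max_left _ _)
    · gcongr; exact le_max_right _ _
  have htend : Filter.Tendsto (fun x' => (x', v x')) (nhdsWithin x (Icc 0 1))
      (nhdsWithin (x, v x) (Icc 0 1 ×ˢ univ)) := by
    refine tendsto_nhdsWithin_iff.2 ⟨?_, ?_⟩
    · have h0 : Filter.Tendsto (fun x' => x' - x) (nhdsWithin x (Icc 0 1)) (nhds 0) := by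
        have : ContinuousAt (fun x' => x' - x) x := by fun_prop
        have := this.tendsto
        rw [sub_self] at this
        exact this.mono_left nhdsWithin_le_nhds
      have := (hbig.trans_tendsto h0).add_const (x, v x)
      simpa using this
    · filter_upwards [self_mem_nhdsWithin] with x' hx' using ⟨hx', mem_univ _⟩
  have h1 := ((hF.hasFDeriv x hx (v x)).isLittleO.comp_tendsto htend).trans_isBigO hbig
  rw [hasDerivWithinAt_iff_isLittleO]
  have h2 := h1.const_mul_left (-(Df (x, v x) (0, 1))⁻¹)
  refine h2.congr' ?_ Filter.EventuallyEq.rfl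
  filter_upwards [self_mem_nhdsWithin] with x' hx'
  have e : ((x', v x') - (x, v x) : ℝ × ℝ) = (x' - x) • ((1:ℝ), (0:ℝ))
      + (v x' - v x) • ((0:ℝ), (1:ℝ)) := by simp
  simp only [Function.comp_apply, Function.uncurry_apply_pair, hv x hx, hv x' hx']
  rw [e, map_add, map_smul, map_smul]
  simp only [smul_eq_mul]
  field_simp
  ring

/-- The reduced solution is twice differentiable with bounded derivatives. -/
lemma exists_reduced (hF : IsReaction m γ f Df DDf) (hm : 0 < m) :
    ∃ (v v1 v2 : ℝ → ℝ) (R C : ℝ), 0 < R ∧ 0 < C ∧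
      (∀ t ∈ Icc (0:ℝ) 1, |f t 0| ≤ m * R ∧ f t (v t) = 0 ∧ |v t| ≤ R ∧ |v1 t| ≤ C ∧ |v2 t| ≤ C ∧
        HasDerivWithinAt v (v1 t) (Icc 0 1) t ∧ HasDerivWithinAt v1 (v2 t) (Icc 0 1) t) := by
  obtain ⟨K0, hK0, h0⟩ := hF.bounded 0
  have hf0 : ∀ x ∈ Icc (0:ℝ) 1, |f x 0| ≤ K0 := fun x hx => (h0 x hx 0 (by simp)).1
  set R := K0 / m with hR
  have hRp : 0 < R := div_pos hK0 hm
  obtain ⟨K, hK, hb⟩ := hF.bounded R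
  have hex : ∀ x : ℝ, ∃ v, x ∈ Icc (0:ℝ) 1 → f x v = 0 ∧ |v| ≤ R := by
    intro x
    by_cases hx : x ∈ Icc (0:ℝ) 1
    · obtain ⟨v, hv⟩ := hF.exists_root hm hx (hf0 x hx)
      exact ⟨v, fun _ => hv⟩
    · exact ⟨0, fun h => absurd h hx⟩
  choose v hv using hex
  have hbD : ∀ x ∈ Icc (0:ℝ) 1, ∀ y, |y| ≤ R → ‖Df (x, y)‖ ≤ K := fun x hx y hy =>
    (hb x hx y hy).2.1
  set A : ℝ → ℝ := fun t => Df (t, v t) (1, 0) with hA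
  set B : ℝ → ℝ := fun t => Df (t, v t) (0, 1) with hBdef
  set v1 : ℝ → ℝ := fun t => -(A t) / B t with hv1
  have d1 : ∀ t ∈ Icc (0:ℝ) 1, HasDerivWithinAt v (v1 t) (Icc 0 1) t := fun t ht =>
    hF.hasDerivWithinAt_root hm hbD (fun x hx => (hv x hx).1) (fun x hx => (hv x hx).2) ht
  have bB : ∀ t ∈ Icc (0:ℝ) 1, m ≤ B t := fun t ht => hF.le_partial t ht _
  have bA : ∀ t ∈ Icc (0:ℝ) 1, |A t| ≤ K := by
    intro t ht
    refine (abs_apply_le _ (by simp)).trans ?_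
    exact hbD t ht _ (hv t ht).2
  have bB' : ∀ t ∈ Icc (0:ℝ) 1, |B t| ≤ K := by
    intro t ht
    refine (abs_apply_le _ (by simp)).trans ?_
    exact hbD t ht _ (hv t ht).2
  have b1 : ∀ t ∈ Icc (0:ℝ) 1, |v1 t| ≤ K / m := by
    intro t ht
    have := bB t ht
    rw [hv1]
    simp only
    rw [abs_div, abs_neg, abs_of_pos (hm.trans_le this)]
    have := bA t ht
    gcongr
  set G : ℝ → (ℝ × ℝ →L[ℝ] ℝ) := fun t => DDf (t, v t) (1, v1 t) with hG
  have bG : ∀ t ∈ Icc (0:ℝ) 1, ‖G t‖ ≤ K * (1 + K / m) := by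
    intro t ht
    refine (ContinuousLinearMap.le_opNorm _ _).trans ?_
    have h1 := (hb t ht _ (hv t ht).2).2.2
    have h2 := (norm_one_prod_le (v1 t)).trans (add_le_add_right (b1 t ht) 1)
    exact mul_le_mul h1 h2 (norm_nonneg _) hK.le
  have dD := fun t (ht : t ∈ Icc (0:ℝ) 1) => hF.hasDerivWithinAt_fderiv_comp ht (d1 t ht)
  have dA : ∀ t ∈ Icc (0:ℝ) 1, HasDerivWithinAt A (G t (1, 0)) (Icc 0 1) t := fun t ht => by
    simpa using (dD t ht).clm_apply (hasDerivWithinAt_const t _ ((1:ℝ), (0:ℝ)))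
  have dB : ∀ t ∈ Icc (0:ℝ) 1, HasDerivWithinAt B (G t (0, 1)) (Icc 0 1) t := fun t ht => by
    simpa using (dD t ht).clm_apply (hasDerivWithinAt_const t _ ((0:ℝ), (1:ℝ)))
  refine ⟨v, v1, fun t => (-(G t (1, 0)) * B t - (-(A t)) * G t (0, 1)) / B t ^ 2, R,
    K / m + (K * (1 + K / m) * K + K * (K * (1 + K / m))) / m ^ 2, hRp, by positivity,
    fun t ht => ⟨?_, (hv t ht).1, (hv t ht).2, ?_, ?_, d1 t ht, ?_⟩⟩
  · rw [hR, mul_div_cancel₀ _ hm.ne']; exact hf0 t ht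
  · refine (b1 t ht).trans (le_add_of_nonneg_right (by positivity))
  · refine le_trans ?_ (le_add_of_nonneg_left (by positivity))
    have hBm := bB t ht
    have g1 : |G t (1, 0)| ≤ K * (1 + K / m) := by
      refine (abs_apply_le _ (by simp)).trans ?_
      exact bG t ht
    have g2 : |G t (0, 1)| ≤ K * (1 + K / m) := by
      refine (abs_apply_le _ (by simp)).trans ?_
      exact bG t ht
    rw [abs_div, abs_of_pos (pow_pos (hm.trans_le hBm) 2)]
    gcongr
    refine (abs_sub _ _).trans ?_
    rw [abs_mul, abs_mul, abs_neg, abs_neg]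
    have := bA t ht
    have := bB' t ht
    gcongr
  · exact (dA t ht).neg.div (dB t ht) (hm.trans_le (bB t ht)).ne'

end IsReaction

lemma layer_nonneg (c ε x : ℝ) : 0 ≤ layer c ε x := by unfold layer; positivity

lemma one_le_layer_zero (c ε : ℝ) : 1 ≤ layer c ε 0 := by
  unfold layer
  have := Real.exp_pos (-(c * (1 - 0) / ε))
  simp only [mul_zero, zero_div, neg_zero, Real.exp_zero]
  linarith

lemma one_le_layer_one (c ε : ℝ) : 1 ≤ layer c ε 1 := by
  unfold layer
  have := Real.exp_pos (-(c * 1 / ε))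
  simp only [sub_self, mul_zero, zero_div, neg_zero, Real.exp_zero]
  linarith

lemma layer_le_two {c ε x : ℝ} (hc : 0 ≤ c) (hε : 0 < ε) (hx : x ∈ Icc (0:ℝ) 1) :
    layer c ε x ≤ 2 := by
  have h0 := hx.1
  have h1 := sub_nonneg.2 hx.2
  have e1 : Real.exp (-(c * x / ε)) ≤ 1 := Real.exp_le_one_iff.2 (neg_nonpos.2 (by positivity))
  have e2 : Real.exp (-(c * (1 - x) / ε)) ≤ 1 :=
    Real.exp_le_one_iff.2 (neg_nonpos.2 (by positivity))
  unfold layer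
  linarith

lemma layer_le_exp_mul_layer {c ε x s : ℝ} (hc : 0 ≤ c) (hε : 0 < ε) (h : |s - x| ≤ ε) :
    layer c ε s ≤ Real.exp c * layer c ε x := by
  have hs := abs_le.1 h
  unfold layer
  rw [mul_add, ← Real.exp_add, ← Real.exp_add]
  have e1 : c * (x - s) / ε ≤ c := by
    rw [div_le_iff₀ hε]; exact mul_le_mul_of_nonneg_left (by linarith) hc
  have e2 : c * (s - x) / ε ≤ c := by
    rw [div_le_iff₀ hε]; exact mul_le_mul_of_nonneg_left (by linarith) hc
  gcongr
  · have : c * (x - s) / ε = c * x / ε - c * s / ε := by ring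
    linarith
  · have : c * (s - x) / ε = c * (1 - x) / ε - c * (1 - s) / ε := by ring
    linarith

lemma hasDerivWithinAt_layer (c ε t : ℝ) :
    HasDerivWithinAt (layer c ε) (-(c / ε) * Real.exp (-(c * t / ε))
      + c / ε * Real.exp (-(c * (1 - t) / ε))) (Icc 0 1) t := by
  have h1 : HasDerivAt (fun t => -(c * t / ε)) (-(c / ε)) t := by
    have := (((hasDerivAt_id t).const_mul c).div_const ε).neg
    simp only [id_eq, mul_one] at this
    exact this
  have h2 : HasDerivAt (fun t => -(c * (1 - t) / ε)) (c / ε) t := by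
    have := ((((hasDerivAt_id t).const_sub 1).const_mul c).div_const ε).neg
    simp only [id_eq, mul_neg, mul_one, neg_div, neg_neg] at this
    exact this
  refine ((h1.exp.add h2.exp).congr_deriv ?_).hasDerivWithinAt
  ring

lemma hasDerivWithinAt_deriv_layer (c ε t : ℝ) :
    HasDerivWithinAt (fun t => -(c / ε) * Real.exp (-(c * t / ε))
      + c / ε * Real.exp (-(c * (1 - t) / ε))) (c ^ 2 / ε ^ 2 * layer c ε t) (Icc 0 1) t := by
  have h1 : HasDerivAt (fun t => -(c * t / ε)) (-(c / ε)) t := by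
    have := (((hasDerivAt_id t).const_mul c).div_const ε).neg
    simp only [id_eq, mul_one] at this
    exact this
  have h2 : HasDerivAt (fun t => -(c * (1 - t) / ε)) (c / ε) t := by
    have := ((((hasDerivAt_id t).const_sub 1).const_mul c).div_const ε).neg
    simp only [id_eq, mul_neg, mul_one, neg_div, neg_neg] at this
    exact this
  refine (((h1.exp.const_mul _).add (h2.exp.const_mul _)).congr_deriv ?_).hasDerivWithinAt
  unfold layer
  ring

namespace IsReaction

variable {m γ : ℝ} {f : ℝ → ℝ → ℝ} {Df : ℝ × ℝ → (ℝ × ℝ →L[ℝ] ℝ)}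
  {DDf : ℝ × ℝ → (ℝ × ℝ →L[ℝ] (ℝ × ℝ →L[ℝ] ℝ))}

/-- The maximum principle bounds solutions of the boundary value problem. -/
lemma abs_solution_le (hF : IsReaction m γ f Df DDf) (hm : 0 < m) {R ε : ℝ} (hR : 0 < R)
    (hε : 0 < ε) (hf0 : ∀ t ∈ Icc (0:ℝ) 1, |f t 0| ≤ m * R) {y y1 : ℝ → ℝ}
    (hy : ∀ t ∈ Icc (0:ℝ) 1, HasDerivWithinAt y (y1 t) (Icc 0 1) t)
    (hy1 : ∀ t ∈ Icc (0:ℝ) 1, HasDerivWithinAt y1 (f t (y t) / ε ^ 2) (Icc 0 1) t)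
    (h0 : y 0 = 0) (h1 : y 1 = 0) : ∀ t ∈ Icc (0:ℝ) 1, |y t| ≤ R := by
  intro t ht
  have hε2 := pow_pos hε 2
  refine abs_le.2 ⟨?_, ?_⟩
  · have := nonpos_of_deriv_two_pos (w := fun t => -y t - R) (fun t ht => (hy t ht).neg.sub_const R)
      (fun t ht => (hy1 t ht).neg) (by simp [h0, hR.le]) (by simp [h1, hR.le])
      (fun t ht hp => ?_) t ht
    · linarith
    · have ht' := Ioo_subset_Icc_self ht
      have a := abs_le.1 (hf0 t ht')
      have b := hF.mul_sub_le ht' (show y t ≤ 0 by linarith)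
      have d : 0 < m * (-y t - R) := mul_pos hm hp
      rw [← neg_div]
      exact div_pos (by linarith) hε2
  · have := nonpos_of_deriv_two_pos (w := fun t => y t - R) (fun t ht => (hy t ht).sub_const R)
      hy1 (by simp [h0, hR.le]) (by simp [h1, hR.le])
      (fun t ht hp => ?_) t ht
    · linarith
    · have ht' := Ioo_subset_Icc_self ht
      have a := abs_le.1 (hf0 t ht')
      have b := hF.mul_sub_le ht' (show 0 ≤ y t by linarith)
      have d : 0 < m * (y t - R) := mul_pos hm hp
      exact div_pos (by linarith) hε2

/-- The solution differs from the reduced solution by `O(ε²)` and boundary layers. -/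
lemma abs_sub_reduced_le (hF : IsReaction m γ f Df DDf) (hm : 0 < m) {R K ε : ℝ}
    (hR : 0 < R) (hK : 0 < K) (hε : 0 < ε) {v v1 v2 y y1 : ℝ → ℝ}
    (hv0 : ∀ t ∈ Icc (0:ℝ) 1, f t (v t) = 0) (hvR : ∀ t ∈ Icc (0:ℝ) 1, |v t| ≤ R)
    (hv2 : ∀ t ∈ Icc (0:ℝ) 1, |v2 t| ≤ K)
    (hv : ∀ t ∈ Icc (0:ℝ) 1, HasDerivWithinAt v (v1 t) (Icc 0 1) t)
    (hv1 : ∀ t ∈ Icc (0:ℝ) 1, HasDerivWithinAt v1 (v2 t) (Icc 0 1) t)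
    (hy : ∀ t ∈ Icc (0:ℝ) 1, HasDerivWithinAt y (y1 t) (Icc 0 1) t)
    (hy1 : ∀ t ∈ Icc (0:ℝ) 1, HasDerivWithinAt y1 (f t (y t) / ε ^ 2) (Icc 0 1) t)
    (h0 : y 0 = 0) (h1 : y 1 = 0) :
    ∀ t ∈ Icc (0:ℝ) 1, |y t - v t| ≤ (K / m + R) * (ε ^ 2 + layer √m ε t) := by
  have hε2 := pow_pos hε 2
  have m0 : (0:ℝ) ∈ Icc (0:ℝ) 1 := ⟨le_rfl, zero_le_one⟩
  have m1 : (1:ℝ) ∈ Icc (0:ℝ) 1 := ⟨zero_le_one, le_rfl⟩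
  have l0 := one_le_layer_zero √m ε
  have l1 := one_le_layer_one √m ε
  have v0 := abs_le.1 (hvR 0 m0)
  have v1' := abs_le.1 (hvR 1 m1)
  have hq : 0 ≤ K / m * ε ^ 2 := by positivity
  have r0 : R ≤ R * layer √m ε 0 := le_mul_of_one_le_right hR.le l0
  have r1 : R ≤ R * layer √m ε 1 := le_mul_of_one_le_right hR.le l1
  have bar : ∀ t ∈ Icc (0:ℝ) 1, |y t - v t| ≤ K / m * ε ^ 2 + R * layer √m ε t := by
    intro t ht
    have db := fun t : ℝ => ((hasDerivWithinAt_layer √m ε t).const_mul R).const_add (K / m * ε ^ 2)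
    have db1 := fun t : ℝ => ((hasDerivWithinAt_deriv_layer √m ε t).const_mul R)
    have e2 : ∀ t, R * (√m ^ 2 / ε ^ 2 * layer √m ε t) = m * (R * layer √m ε t) / ε ^ 2 := by
      intro t; rw [Real.sq_sqrt hm.le]; ring
    have e3 : m * (K / m * ε ^ 2) / ε ^ 2 = K := by field_simp
    refine abs_le.2 ⟨?_, ?_⟩
    · have := nonpos_of_deriv_two_pos
        (w := fun t => -(y t - v t) - (K / m * ε ^ 2 + R * layer √m ε t))
        (fun t ht => ((hy t ht).sub (hv t ht)).neg.sub (db t))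
        (fun t ht => ((hy1 t ht).sub (hv1 t ht)).neg.sub (db1 t))
        (by linarith) (by linarith) (fun t ht hp => ?_) t ht
      · linarith
      · have ht' := Ioo_subset_Icc_self ht
        have a := abs_le.1 (hv2 t ht')
        have hL := mul_nonneg hR.le (layer_nonneg √m ε t)
        have b := hF.mul_sub_le ht' (show y t ≤ v t by linarith)
        rw [hv0 t ht'] at b
        have d : 0 < m * (-(y t - v t) - (K / m * ε ^ 2 + R * layer √m ε t)) := mul_pos hm hp
        have : (m * (K / m * ε ^ 2) + m * (R * layer √m ε t)) / ε ^ 2 < -(f t (y t)) / ε ^ 2 :=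
          div_lt_div_of_pos_right (by linarith) hε2
        rw [add_div, e3, neg_div] at this
        rw [e2]
        linarith
    · have := nonpos_of_deriv_two_pos
        (w := fun t => (y t - v t) - (K / m * ε ^ 2 + R * layer √m ε t))
        (fun t ht => ((hy t ht).sub (hv t ht)).sub (db t))
        (fun t ht => ((hy1 t ht).sub (hv1 t ht)).sub (db1 t))
        (by linarith) (by linarith) (fun t ht hp => ?_) t ht
      · linarith
      · have ht' := Ioo_subset_Icc_self ht
        have a := abs_le.1 (hv2 t ht')
        have hL := mul_nonneg hR.le (layer_nonneg √m ε t)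
        have b := hF.mul_sub_le ht' (show v t ≤ y t by linarith)
        rw [hv0 t ht'] at b
        have d : 0 < m * ((y t - v t) - (K / m * ε ^ 2 + R * layer √m ε t)) := mul_pos hm hp
        have : (m * (K / m * ε ^ 2) + m * (R * layer √m ε t)) / ε ^ 2 < f t (y t) / ε ^ 2 :=
          div_lt_div_of_pos_right (by linarith) hε2
        rw [add_div, e3] at this
        rw [e2]
        linarith
  intro t ht
  refine (bar t ht).trans ?_
  have := layer_nonneg √m ε t
  have : 0 ≤ R * ε ^ 2 := by positivity
  have : 0 ≤ K / m * layer √m ε t := by positivity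
  linarith

/-- Layer bound for the first derivative, from interpolation between `y` and `y''`. -/
lemma abs_deriv_le_of_layer {S K G c ε : ℝ} (hS : 0 ≤ S) (hK : 0 ≤ K) (hG : 0 ≤ G) (hc : 0 ≤ c)
    (hε : 0 < ε) (hε2 : ε ≤ 1 / 2) {y y1 g v v1 : ℝ → ℝ}
    (hy : ∀ t ∈ Icc (0:ℝ) 1, HasDerivWithinAt y (y1 t) (Icc 0 1) t)
    (hy1 : ∀ t ∈ Icc (0:ℝ) 1, HasDerivWithinAt y1 (g t / ε ^ 2) (Icc 0 1) t)
    (hv : ∀ t ∈ Icc (0:ℝ) 1, HasDerivWithinAt v (v1 t) (Icc 0 1) t)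
    (bv1 : ∀ t ∈ Icc (0:ℝ) 1, |v1 t| ≤ K)
    (bs : ∀ t ∈ Icc (0:ℝ) 1, |y t - v t| ≤ S * (ε ^ 2 + layer c ε t))
    (bg : ∀ t ∈ Icc (0:ℝ) 1, |g t| ≤ G * (ε ^ 2 + layer c ε t)) :
    ∀ t ∈ Icc (0:ℝ) 1, |y1 t| ≤ (K + 4 * S * Real.exp c + G * Real.exp c)
      * (1 + layer c ε t / ε) := by
  intro x hx
  obtain ⟨x', hx', hd⟩ : ∃ x' ∈ Icc (0:ℝ) 1, |x' - x| = ε := by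
    rcases le_total x (1 / 2) with h | h
    · exact ⟨x + ε, ⟨by linarith [hx.1], by linarith⟩, by simp [abs_of_pos hε]⟩
    · exact ⟨x - ε, ⟨by linarith, by linarith [hx.2]⟩, by simp [abs_of_pos hε]⟩
  have hE : 1 ≤ Real.exp c := Real.one_le_exp hc
  set E := Real.exp c
  have hL := layer_nonneg c ε x
  have hT := abs_taylor_two_le hy hy1 hx hx' (K := G * (ε ^ 2 + E * layer c ε x) / ε ^ 2) (by
    intro t ht
    have ht1 : t ∈ Icc (0:ℝ) 1 := uIcc_subset_Icc hx hx' ht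
    have ht2 : |t - x| ≤ ε := (abs_sub_left_of_mem_uIcc ht).trans hd.le
    rw [abs_div, abs_of_pos (pow_pos hε 2)]
    gcongr
    refine (bg t ht1).trans ?_
    gcongr
    exact layer_le_exp_mul_layer hc hε ht2)
  have hsq : (x' - x) ^ 2 = ε ^ 2 := by rw [← hd, sq_abs]
  rw [hsq] at hT
  have lip : |v x' - v x| ≤ K * ε := by
    have := (convex_Icc (0:ℝ) 1).norm_image_sub_le_of_norm_hasDerivWithin_le hv bv1 hx hx'
    simpa [Real.norm_eq_abs, hd] using this
  have b1 : |y x' - v x'| ≤ S * (ε ^ 2 + E * layer c ε x) := by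
    refine (bs x' hx').trans ?_
    gcongr
    exact layer_le_exp_mul_layer hc hε hd.le
  have b2 := bs x hx
  have tri : ε * |y1 x| ≤ K * ε + S * (ε ^ 2 + E * layer c ε x) + S * (ε ^ 2 + layer c ε x)
      + G * (ε ^ 2 + E * layer c ε x) / 2 := by
    have e : (x' - x) * y1 x = (y x' - v x') + (v x' - v x) + (-(y x - v x))
        + -(y x' - y x - (x' - x) * y1 x) := by ring
    have h1 : ε * |y1 x| = |(x' - x) * y1 x| := by rw [abs_mul, hd]
    have h2 := abs_add_le ((y x' - v x') + (v x' - v x) + (-(y x - v x)))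
      (-(y x' - y x - (x' - x) * y1 x))
    have h3 := abs_add_three (y x' - v x') (v x' - v x) (-(y x - v x))
    rw [abs_neg] at h2 h3
    rw [← e, ← h1] at h2
    have h4 : G * (ε ^ 2 + E * layer c ε x) / ε ^ 2 / 2 * ε ^ 2
        = G * (ε ^ 2 + E * layer c ε x) / 2 := by field_simp
    linarith
  rw [← mul_le_mul_iff_right₀ hε]
  refine tri.trans ?_
  have e : ε * ((K + 4 * S * E + G * E) * (1 + layer c ε x / ε))
      = (K + 4 * S * E + G * E) * (ε + layer c ε x) := by field_simp
  rw [e]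
  have i1 : ε ^ 2 ≤ E * ε := by nlinarith
  have i2 : layer c ε x ≤ E * layer c ε x := le_mul_of_one_le_left hL hE
  have j1 := mul_le_mul_of_nonneg_left i1 hS
  have j2 := mul_le_mul_of_nonneg_left i1 hG
  have j3 := mul_le_mul_of_nonneg_left i2 hS
  have j4 := mul_le_mul_of_nonneg_left i2 hG
  have k0 := mul_nonneg hK hL
  have k1 : 0 ≤ S * (E * ε) := by positivity
  have k2 : 0 ≤ S * (E * layer c ε x) := by positivity
  have k3 : 0 ≤ G * (E * layer c ε x) := by positivity
  have k4 : 0 ≤ G * (E * ε) := by positivity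
  linarith

/-- Solutions of the boundary value problem satisfy layer bounds uniformly in `ε`. -/
lemma exists_layerBounds (hF : IsReaction m γ f Df DDf) (hm : 0 < m) :
    ∃ C > 0, ∃ v v1 v2 : ℝ → ℝ, ∀ ε > 0, ε ≤ 1 / 2 → ∀ y y1 : ℝ → ℝ,
      (∀ t ∈ Icc (0:ℝ) 1, HasDerivWithinAt y (y1 t) (Icc 0 1) t) →
      (∀ t ∈ Icc (0:ℝ) 1, HasDerivWithinAt y1 (f t (y t) / ε ^ 2) (Icc 0 1) t) →
      y 0 = 0 → y 1 = 0 →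
      ∃ g1 g2 : ℝ → ℝ, HasLayerBounds C √m ε y y1 (fun t => f t (y t)) g1 g2 v v1 v2 := by
  obtain ⟨v, v1, v2, R, Cv, hR, hCv, H⟩ := hF.exists_reduced hm
  obtain ⟨K, hK, hb⟩ := hF.bounded R
  have hγ : 0 < γ := by
    obtain ⟨b, h1, h2, -⟩ := hF.mono 0 ⟨le_rfl, zero_le_one⟩ 0 0
    linarith
  set Cs := Cv / m + R with hCs
  have hCs0 : 0 < Cs := by positivity
  set Cy := Cv + 4 * Cs * Real.exp √m + γ * Cs * Real.exp √m with hCy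
  have hCy0 : 0 < Cy := by positivity
  refine ⟨Cv + Cs + γ * Cs + Cy + K * (1 + Cy) + (4 * K * (1 + Cy) ^ 2 + K * (γ * Cs)),
    by positivity, v, v1, v2, fun ε hε hε2 y y1 hy hy1 h0 h1 => ?_⟩
  have hεp := pow_pos hε 2
  have by0 := hF.abs_solution_le hm hR hε (fun t ht => (H t ht).1) hy hy1 h0 h1
  have bs := hF.abs_sub_reduced_le hm hR hCv hε (v := v) (v1 := v1) (v2 := v2)
    (fun t ht => (H t ht).2.1) (fun t ht => (H t ht).2.2.1) (fun t ht => (H t ht).2.2.2.2.1)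
    (fun t ht => (H t ht).2.2.2.2.2.1) (fun t ht => (H t ht).2.2.2.2.2.2) hy hy1 h0 h1
  have bg : ∀ t ∈ Icc (0:ℝ) 1, |f t (y t)| ≤ γ * Cs * (ε ^ 2 + layer √m ε t) := by
    intro t ht
    have := hF.abs_sub_le_mul hm (y t) (v t) ht
    rw [(H t ht).2.1, sub_zero] at this
    rw [mul_assoc]
    exact this.trans (mul_le_mul_of_nonneg_left (bs t ht) hγ.le)
  have by1 := abs_deriv_le_of_layer hCs0.le hCv.le (by positivity) (Real.sqrt_nonneg m) hε hε2
    hy hy1 (fun t ht => (H t ht).2.2.2.2.2.1) (fun t ht => (H t ht).2.2.2.1) bs bg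
  have b1 : ∀ t ∈ Icc (0:ℝ) 1, 1 + |y1 t| ≤ (1 + Cy) * (1 + layer √m ε t / ε) := by
    intro t ht
    have := by1 t ht
    have : 0 ≤ layer √m ε t / ε := div_nonneg (layer_nonneg _ _ _) hε.le
    linarith
  have up : ∀ {A B X z : ℝ}, 0 ≤ X → A ≤ B → z ≤ A * X → z ≤ B * X := fun hX hAB hz =>
    hz.trans (mul_le_mul_of_nonneg_right hAB hX)
  have nn1 : ∀ t, 0 ≤ ε ^ 2 + layer √m ε t := fun t => add_nonneg hεp.le (layer_nonneg _ _ _)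
  have nn2 : ∀ t, 0 ≤ 1 + layer √m ε t / ε := fun t =>
    add_nonneg zero_le_one (div_nonneg (layer_nonneg _ _ _) hε.le)
  have nn3 : ∀ t, 0 ≤ 1 + layer √m ε t / ε ^ 2 := fun t =>
    add_nonneg zero_le_one (div_nonneg (layer_nonneg _ _ _) hεp.le)
  have p1 : 0 < γ * Cs := by positivity
  have p2 : 0 < K * (1 + Cy) := by positivity
  have p3 : 0 < 4 * K * (1 + Cy) ^ 2 + K * (γ * Cs) := by positivity
  refine ⟨fun t => Df (t, y t) (1, y1 t),
    fun t => DDf (t, y t) (1, y1 t) (1, y1 t) + Df (t, y t) (0, f t (y t) / ε ^ 2),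
    { hy := hy
      hy1 := hy1
      hg := fun t ht => hF.hasDerivWithinAt_comp ht (hy t ht)
      hg1 := fun t ht => (hF.hasDerivWithinAt_fderiv_comp ht (hy t ht)).clm_apply
        ((hasDerivWithinAt_const t _ (1:ℝ)).prodMk (hy1 t ht))
      hv := fun t ht => (H t ht).2.2.2.2.2.1
      hv1 := fun t ht => (H t ht).2.2.2.2.2.2
      v1_le := fun t ht => (H t ht).2.2.2.1.trans (by linarith)
      v2_le := fun t ht => (H t ht).2.2.2.2.1.trans (by linarith)
      sub_le := fun t ht => up (nn1 t) (by linarith) (bs t ht)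
      y1_le := fun t ht => up (nn2 t) (by linarith) (by1 t ht)
      g_le := fun t ht => up (nn1 t) (by linarith) (bg t ht)
      g1_le := fun t ht => ?_
      g2_le := fun t ht => ?_ }⟩
  · refine up (nn2 t) (A := K * (1 + Cy)) (by linarith) ?_
    have hD := (hb t ht _ (by0 t ht)).2.1
    calc |Df (t, y t) (1, y1 t)| ≤ ‖Df (t, y t)‖ * ‖((1:ℝ), y1 t)‖ :=
          ContinuousLinearMap.le_opNorm (Df (t, y t)) _
      _ ≤ K * ((1 + Cy) * (1 + layer √m ε t / ε)) := by
          gcongr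
          exact (norm_one_prod_le _).trans (b1 t ht)
      _ = _ := by ring
  · refine up (nn3 t) (A := 4 * K * (1 + Cy) ^ 2 + K * (γ * Cs)) (by linarith) ?_
    have hD := (hb t ht _ (by0 t ht)).2.1
    have hDD := (hb t ht _ (by0 t ht)).2.2
    have hn := (norm_one_prod_le (y1 t)).trans (b1 t ht)
    have hL := layer_nonneg √m ε t
    have hL2 := layer_le_two (Real.sqrt_nonneg m) hε ht
    have a1 : |DDf (t, y t) (1, y1 t) (1, y1 t)| ≤ 4 * K * (1 + Cy) ^ 2
        * (1 + layer √m ε t / ε ^ 2) := by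
      calc _ ≤ ‖DDf (t, y t) (1, y1 t)‖ * ‖((1:ℝ), y1 t)‖ :=
            ContinuousLinearMap.le_opNorm (DDf (t, y t) (1, y1 t)) _
        _ ≤ ‖DDf (t, y t)‖ * ‖((1:ℝ), y1 t)‖ * ‖((1:ℝ), y1 t)‖ := by
            gcongr
            exact ContinuousLinearMap.le_opNorm _ _
        _ ≤ K * ((1 + Cy) * (1 + layer √m ε t / ε)) * ((1 + Cy) * (1 + layer √m ε t / ε)) := by
            have := nn2 t
            gcongr
        _ = K * (1 + Cy) ^ 2 * (1 + layer √m ε t / ε) ^ 2 := by ring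
        _ ≤ K * (1 + Cy) ^ 2 * (4 * (1 + layer √m ε t / ε ^ 2)) := by
            gcongr
            have e1 : (layer √m ε t / ε) ^ 2 ≤ 2 * (layer √m ε t / ε ^ 2) := by
              rw [div_pow, ← mul_div_assoc]
              gcongr
              nlinarith
            linarith [sq_nonneg (layer √m ε t / ε - 1)]
        _ = _ := by ring
    have a2 : |Df (t, y t) (0, f t (y t) / ε ^ 2)| ≤ K * (γ * Cs)
        * (1 + layer √m ε t / ε ^ 2) := by
      calc _ ≤ ‖Df (t, y t)‖ * ‖((0:ℝ), f t (y t) / ε ^ 2)‖ :=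
            ContinuousLinearMap.le_opNorm (Df (t, y t)) _
        _ = ‖Df (t, y t)‖ * (|f t (y t)| / ε ^ 2) := by
            rw [Prod.norm_mk, norm_zero, max_eq_right (norm_nonneg _), Real.norm_eq_abs, abs_div,
              abs_of_pos hεp]
        _ ≤ K * (γ * Cs * (ε ^ 2 + layer √m ε t) / ε ^ 2) := by
            gcongr
            exact bg t ht
        _ = _ := by field_simp
    refine (abs_add_le _ _).trans ((add_le_add a1 a2).trans (le_of_eq (by ring)))

end IsReaction

lemma hasDerivAt_ite_le {f g f' g' : ℝ → ℝ} {α : ℝ} (hf : ∀ t ≤ α, HasDerivAt f (f' t) t)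
    (hg : ∀ t, α ≤ t → HasDerivAt g (g' t) t) (h : f α = g α) (h' : f' α = g' α) (t : ℝ) :
    HasDerivAt (fun t => if t ≤ α then f t else g t) (if t ≤ α then f' t else g' t) t := by
  rcases lt_trichotomy t α with ht | rfl | ht
  · rw [if_pos ht.le]
    refine (hf t ht.le).congr_of_eventuallyEq ?_
    filter_upwards [Iio_mem_nhds ht] with s hs using if_pos (le_of_lt hs)
  · rw [if_pos le_rfl]
    have h1 : HasDerivWithinAt (fun s => if s ≤ t then f s else g s) (f' t) (Iic t) t :=
      (hf t le_rfl).hasDerivWithinAt.congr (fun s hs => if_pos hs) (if_pos le_rfl)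
    have h2 : HasDerivWithinAt (fun s => if s ≤ t then f s else g s) (f' t) (Ici t) t := by
      rw [h']
      refine (hg t le_rfl).hasDerivWithinAt.congr (fun s hs => ?_) ((if_pos le_rfl).trans h)
      rcases (mem_Ici.1 hs).eq_or_lt with rfl | hs
      · exact (if_pos le_rfl).trans h
      · exact if_neg hs.not_ge
    simpa [Iic_union_Ici, hasDerivWithinAt_univ] using h1.union h2
  · rw [if_neg ht.not_ge]
    refine (hg t ht.le).congr_of_eventuallyEq ?_
    filter_upwards [Ioi_mem_nhds ht] with s hs using if_neg (not_le.2 hs)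

lemma second_diff_bounds {Φ Φ1 Φ2 : ℝ → ℝ} (hΦ : ∀ t, HasDerivAt Φ (Φ1 t) t)
    (hΦ1 : ∀ t, HasDerivAt Φ1 (Φ2 t) t) {u δ B1 B2 : ℝ} (hδ : 0 < δ)
    (h0 : ∀ t ∈ Icc u (u + 2 * δ), 0 ≤ Φ2 t) (hB1 : ∀ t ∈ Icc u (u + 2 * δ), Φ1 t ≤ B1)
    (hB2 : ∀ t ∈ Icc u (u + 2 * δ), Φ2 t ≤ B2) :
    Φ1 u * δ ≤ Φ (u + δ) - Φ u ∧ Φ (u + δ) - Φ u ≤ Φ (u + 2 * δ) - Φ (u + δ) ∧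
      Φ (u + 2 * δ) - Φ (u + δ) ≤ B1 * δ ∧
      (Φ (u + 2 * δ) - Φ (u + δ)) - (Φ (u + δ) - Φ u) ≤ B2 * δ ^ 2 := by
  have mvt : ∀ {F F' : ℝ → ℝ}, (∀ t, HasDerivAt F (F' t) t) → ∀ {x y : ℝ}, x < y →
      ∃ z ∈ Ioo x y, F y - F x = F' z * (y - x) := by
    intro F F' hF x y hxy
    obtain ⟨z, hz, e⟩ := exists_hasDerivAt_eq_slope F F' hxy
      (fun t _ => (hF t).continuousAt.continuousWithinAt) (fun t _ => hF t)
    exact ⟨z, hz, by rw [e, div_mul_cancel₀ _ (sub_pos.2 hxy).ne']⟩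
  refine ⟨?_, ?_, ?_, ?_⟩
  · obtain ⟨z, hz, e⟩ := mvt hΦ (show u < u + δ by linarith)
    obtain ⟨z', hz', e'⟩ := mvt hΦ1 hz.1
    have := h0 z' ⟨hz'.1.le, by linarith [hz'.2, hz.2]⟩
    have : 0 ≤ Φ2 z' * (z - u) := mul_nonneg this (by linarith [hz.1])
    rw [e, add_sub_cancel_left]
    gcongr
    linarith
  · obtain ⟨z, hz, e⟩ := mvt hΦ (show u < u + δ by linarith)
    obtain ⟨w, hw, e2⟩ := mvt hΦ (show u + δ < u + 2 * δ by linarith)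
    obtain ⟨z', hz', e'⟩ := mvt hΦ1 (hz.2.trans hw.1)
    have := h0 z' ⟨by linarith [hz'.1, hz.1], by linarith [hz'.2, hw.2]⟩
    have : 0 ≤ Φ2 z' * (w - z) := mul_nonneg this (by linarith [hz.2, hw.1])
    rw [e, e2]
    have e3 : u + 2 * δ - (u + δ) = u + δ - u := by ring
    rw [e3]
    exact mul_le_mul_of_nonneg_right (by linarith) (by linarith)
  · obtain ⟨w, hw, e2⟩ := mvt hΦ (show u + δ < u + 2 * δ by linarith)
    rw [e2, show u + 2 * δ - (u + δ) = δ by ring]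
    exact mul_le_mul_of_nonneg_right (hB1 w ⟨by linarith [hw.1], hw.2.le⟩) hδ.le
  · have hψ : ∀ t, HasDerivAt (fun t => Φ (t + δ) - Φ t) (Φ1 (t + δ) - Φ1 t) t := fun t =>
      ((hΦ (t + δ)).comp_add_const t δ).sub (hΦ t)
    obtain ⟨z, hz, e⟩ := mvt hψ (show u < u + δ by linarith)
    obtain ⟨z', hz', e'⟩ := mvt hΦ1 (show z < z + δ by linarith)
    have := hB2 z' ⟨by linarith [hz'.1, hz.1], by linarith [hz'.2, hz.2]⟩
    rw [show u + δ + δ = u + 2 * δ by ring] at e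
    rw [e, e', add_sub_cancel_left, add_sub_cancel_left]
    calc Φ2 z' * δ * δ ≤ B2 * δ * δ := by gcongr
      _ = _ := by ring

/-- The mesh generating function on the left half of the interval, extended by its cubic part,
in terms of `s = ε^{1/3}`. -/
noncomputable def halfMap (a p s ω t : ℝ) : ℝ :=
  if t ≤ p - s then a * s ^ 3 * t / (p - t)
  else ω * (t - (p - s)) ^ 3 + a * p * (t - (p - s)) ^ 2 + a * p * s * (t - (p - s))
    + a * s ^ 2 * (p - s)

/-- First derivative of `halfMap`. -/
noncomputable def halfMapDeriv (a p s ω t : ℝ) : ℝ :=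
  if t ≤ p - s then a * p * s ^ 3 / (p - t) ^ 2
  else 3 * ω * (t - (p - s)) ^ 2 + 2 * a * p * (t - (p - s)) + a * p * s

/-- Second derivative of `halfMap`. -/
noncomputable def halfMapDerivTwo (a p s ω t : ℝ) : ℝ :=
  if t ≤ p - s then 2 * a * p * s ^ 3 / (p - t) ^ 3
  else 6 * ω * (t - (p - s)) + 2 * a * p

lemma hasDerivAt_halfMap {a p s ω : ℝ} (hs : 0 < s) (t : ℝ) :
    HasDerivAt (halfMap a p s ω) (halfMapDeriv a p s ω t) t := by
  refine hasDerivAt_ite_le (f := fun t => a * s ^ 3 * t / (p - t))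
    (g := fun t => ω * (t - (p - s)) ^ 3 + a * p * (t - (p - s)) ^ 2 + a * p * s * (t - (p - s))
      + a * s ^ 2 * (p - s)) (f' := fun t => a * p * s ^ 3 / (p - t) ^ 2)
    (g' := fun t => 3 * ω * (t - (p - s)) ^ 2 + 2 * a * p * (t - (p - s)) + a * p * s)
    (fun t ht => ?_) (fun t _ => ?_) ?_ ?_ t
  · have hpt : p - t ≠ 0 := by linarith
    refine (((hasDerivAt_id' t).const_mul (a * s ^ 3)).div
      ((hasDerivAt_id' t).const_sub p) hpt).congr_deriv ?_
    field_simp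
    ring
  · have h := (hasDerivAt_id' t).sub_const (p - s)
    refine (((((h.pow 3).const_mul ω).add ((h.pow 2).const_mul (a * p))).add
      (h.const_mul (a * p * s))).add_const (a * s ^ 2 * (p - s))).congr_deriv ?_
    push_cast
    ring
  · rw [sub_sub_cancel, sub_self]
    field_simp
    ring
  · rw [sub_sub_cancel, sub_self]
    field_simp
    ring

lemma hasDerivAt_halfMapDeriv {a p s ω : ℝ} (hs : 0 < s) (t : ℝ) :
    HasDerivAt (halfMapDeriv a p s ω) (halfMapDerivTwo a p s ω t) t := by
  refine hasDerivAt_ite_le (f := fun t => a * p * s ^ 3 / (p - t) ^ 2)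
    (g := fun t => 3 * ω * (t - (p - s)) ^ 2 + 2 * a * p * (t - (p - s)) + a * p * s)
    (f' := fun t => 2 * a * p * s ^ 3 / (p - t) ^ 3)
    (g' := fun t => 6 * ω * (t - (p - s)) + 2 * a * p) (fun t ht => ?_) (fun t _ => ?_) ?_ ?_ t
  · have hpt : p - t ≠ 0 := by linarith
    refine ((hasDerivAt_const t (a * p * s ^ 3)).div
      (((hasDerivAt_id' t).const_sub p).pow 2) (pow_ne_zero 2 hpt)).congr_deriv ?_
    simp only [Nat.cast_ofNat, Pi.pow_apply]
    field_simp
    ring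
  · have h := (hasDerivAt_id' t).sub_const (p - s)
    refine ((((h.pow 2).const_mul (3 * ω)).add (h.const_mul (2 * a * p))).add_const
      (a * p * s)).congr_deriv ?_
    push_cast
    ring
  · rw [sub_sub_cancel, sub_self]
    field_simp
    ring
  · rw [sub_sub_cancel, sub_self]
    field_simp
    ring

lemma halfMapDerivTwo_nonneg {a p s ω : ℝ} (ha : 0 ≤ a) (hp : 0 ≤ p) (hs : 0 < s) (hω : 0 ≤ ω)
    (t : ℝ) : 0 ≤ halfMapDerivTwo a p s ω t := by
  unfold halfMapDerivTwo
  split_ifs with h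
  · have : 0 ≤ p - t := by linarith
    positivity
  · have : 0 ≤ t - (p - s) := by linarith
    positivity

lemma halfMapDeriv_pos {a p s ω : ℝ} (ha : 0 < a) (hp : 0 < p) (hs : 0 < s) (hω : 0 ≤ ω)
    (t : ℝ) : 0 < halfMapDeriv a p s ω t := by
  unfold halfMapDeriv
  split_ifs with h
  · have : 0 < p - t := by linarith
    positivity
  · have : 0 < t - (p - s) := by linarith
    positivity

lemma strictMono_halfMap {a p s ω : ℝ} (ha : 0 < a) (hp : 0 < p) (hs : 0 < s) (hω : 0 ≤ ω) :
    StrictMono (halfMap a p s ω) :=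
  strictMono_of_deriv_pos fun t => by
    rw [(hasDerivAt_halfMap hs t).deriv]
    exact halfMapDeriv_pos ha hp hs hω t

lemma halfMapDeriv_le {a p s ω W t : ℝ} (ha : 0 < a) (hp : 0 < p) (hs : 0 < s) (hsp : s < p)
    (hp1 : p ≤ 1) (hω : 0 ≤ ω) (hωW : ω ≤ W) (ht : t ≤ 1) :
    halfMapDeriv a p s ω t ≤ 6 * W + 3 * a * p := by
  have hW : 0 ≤ W := hω.trans hωW
  have hap : 0 < a * p := mul_pos ha hp
  have h1 : a * p * s ≤ a * p := mul_le_of_le_one_right hap.le (by linarith)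
  unfold halfMapDeriv
  split_ifs with h
  · have hst : s ≤ p - t := by linarith
    have : a * p * s ^ 3 / (p - t) ^ 2 ≤ a * p * s := by
      rw [div_le_iff₀ (by nlinarith)]
      calc a * p * s ^ 3 = a * p * s * s ^ 2 := by ring
        _ ≤ _ := by gcongr
    linarith
  · have h0 : 0 ≤ t - (p - s) := by linarith
    have h2 : t - (p - s) ≤ 1 := by linarith
    have : 3 * ω * (t - (p - s)) ^ 2 ≤ 3 * W * 1 := by
      gcongr
      exact pow_le_one₀ h0 h2
    have : 2 * a * p * (t - (p - s)) ≤ 2 * a * p * 1 := by gcongr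
    linarith

lemma halfMapDerivTwo_le {a p s ω W t : ℝ} (ha : 0 < a) (hp : 0 < p) (hs : 0 < s) (hsp : s < p)
    (hω : 0 ≤ ω) (hωW : ω ≤ W) (ht : t ≤ 1) :
    halfMapDerivTwo a p s ω t ≤ 6 * W + 3 * a * p := by
  have hW : 0 ≤ W := hω.trans hωW
  have hap : 0 < a * p := mul_pos ha hp
  unfold halfMapDerivTwo
  split_ifs with h
  · have hst : s ≤ p - t := by linarith
    have : 2 * a * p * s ^ 3 / (p - t) ^ 3 ≤ 2 * a * p := by
      rw [div_le_iff₀ (pow_pos (by linarith) 3)]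
      gcongr
    linarith
  · have h2 : t - (p - s) ≤ 1 := by linarith
    have : 6 * ω * (t - (p - s)) ≤ 6 * W * 1 := by gcongr; linarith
    linarith

/-- The layer exponential at a mesh point decays faster than powers of the distance to `p`. -/
lemma exp_halfMap_le {a p s ω c u : ℝ} (ha : 0 < a) (hp : 0 < p) (hs : 0 < s) (hc : 0 < c)
    (hω : 0 ≤ ω) :
    Real.exp (-(c * halfMap a p s ω u / s ^ 3)) ≤
      Real.exp (c * a) * (720 / (c * a * p) ^ 6) * max (p - u) s ^ 6 := by
  set r := max (p - u) s with hr
  have hr0 : 0 < r := lt_of_lt_of_le hs (le_max_right _ _)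
  have hrs : p - r ≤ p - s := by linarith [le_max_right (p - u) s]
  have hmono : halfMap a p s ω (p - r) ≤ halfMap a p s ω u :=
    (strictMono_halfMap ha hp hs hω).monotone (by linarith [le_max_left (p - u) s])
  have e : halfMap a p s ω (p - r) = s ^ 3 * (a * p / r - a) := by
    unfold halfMap
    rw [if_pos hrs, sub_sub_cancel]
    field_simp
  have h1 : c * a * p / r - c * a ≤ c * halfMap a p s ω u / s ^ 3 := by
    rw [le_div_iff₀ (pow_pos hs 3)]
    calc _ = c * (s ^ 3 * (a * p / r - a)) := by ring
      _ ≤ _ := by rw [← e]; gcongr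
  set z := c * a * p / r with hz
  have hz0 : 0 < z := by positivity
  have h2 : Real.exp (-z) ≤ 720 / z ^ 6 := by
    have := Real.pow_div_factorial_le_exp z hz0.le 6
    rw [show (Nat.factorial 6 : ℝ) = 720 by norm_num [Nat.factorial]] at this
    rw [Real.exp_neg, ← inv_div]
    exact inv_anti₀ (by positivity) this
  calc _ ≤ Real.exp (c * a + -z) := Real.exp_le_exp.2 (by linarith)
    _ = Real.exp (c * a) * Real.exp (-z) := Real.exp_add _ _
    _ ≤ Real.exp (c * a) * (720 / z ^ 6) := by gcongr
    _ = _ := by rw [hz]; field_simp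

/-- Two consecutive steps of the mesh generating function: either the layer is resolved, or the
layer is negligible and the steps are not small compared with `ε`. -/
lemma exists_halfMap_steps {a p c W : ℝ} (ha : 0 < a) (hp : 0 < p) (hp1 : p ≤ 1) (hc : 0 < c)
    (hW : 0 ≤ W) :
    ∃ C > 0, ∃ b > 0, ∀ s ω δ u : ℝ, 0 < s → s < p → 0 ≤ ω → ω ≤ W → 0 < δ → δ ≤ 1 →
      0 ≤ u → u + 2 * δ ≤ 1 → ∀ h H M : ℝ, h = halfMap a p s ω (u + δ) - halfMap a p s ω u →
      H = halfMap a p s ω (u + 2 * δ) - halfMap a p s ω (u + δ) →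
      M = 2 * Real.exp (-(c * halfMap a p s ω u / s ^ 3)) →
      0 < h ∧ h ≤ H ∧ H ≤ C * δ ∧ H - h ≤ C * δ ^ 2 ∧
      ((M / s ^ 3 * (H - h) ≤ C * δ ^ 2 ∧ M / (s ^ 3) ^ 2 * H ^ 2 ≤ C * δ ^ 2) ∨
        (s ^ 3 ≤ C * δ ^ 2 ∧ M ≤ C * δ ^ 2 ∧ b * s ^ 3 ≤ h)) := by
  set K := 6 * W + 3 * a * p with hK
  have hap : 0 < a * p := mul_pos ha hp
  have hK0 : 0 < K := by positivity
  set A := 2 * (Real.exp (c * a) * (720 / (c * a * p) ^ 6)) with hA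
  have hA0 : 0 < A := by positivity
  refine ⟨K + 64 * A * K + 64 * A * K ^ 2 + 16 * A * (a * p) + 16 * A * (a * p) ^ 2 + 8 + 16 * A,
    by positivity, a * p / 4, by positivity, ?_⟩
  intro s ω δ u hs hsp hω hωW hδ hδ1 hu0 hu h H M hh hH hM
  have dΦ := hasDerivAt_halfMap (a := a) (p := p) (ω := ω) hs
  have dΦ1 := hasDerivAt_halfMapDeriv (a := a) (p := p) (ω := ω) hs
  have n2 := fun t (_ : t ∈ Icc u (u + 2 * δ)) =>
    halfMapDerivTwo_nonneg ha.le hp.le hs hω (p := p) t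
  obtain ⟨g1, g2, g3, g4⟩ := second_diff_bounds dΦ dΦ1 hδ n2
    (fun t ht => halfMapDeriv_le ha hp hs hsp hp1 hω hωW (ht.2.trans hu))
    (fun t ht => halfMapDerivTwo_le ha hp hs hsp hω hωW (ht.2.trans hu))
  rw [← hh] at g1 g2 g4
  rw [← hH] at g2 g3 g4
  have h0 : 0 < h := (mul_pos (halfMapDeriv_pos ha hp hs hω u) hδ).trans_le g1
  have hMle : M ≤ A * max (p - u) s ^ 6 := by
    have := exp_halfMap_le (u := u) ha hp hs hc hω (p := p)
    rw [hM, hA]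
    linarith
  have hM0 : 0 < M := by rw [hM]; positivity
  have hδ2 : 0 < δ ^ 2 := pow_pos hδ 2
  have up : ∀ {Q z X : ℝ}, 0 ≤ X → Q ≤ K + 64 * A * K + 64 * A * K ^ 2 + 16 * A * (a * p)
      + 16 * A * (a * p) ^ 2 + 8 + 16 * A → z ≤ Q * X → z ≤ (K + 64 * A * K + 64 * A * K ^ 2
      + 16 * A * (a * p) + 16 * A * (a * p) ^ 2 + 8 + 16 * A) * X := fun hX hQ hz =>
    hz.trans (mul_le_mul_of_nonneg_right hQ hX)
  have p1 : 0 < 64 * A * K := by positivity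
  have p2 : 0 < 64 * A * K ^ 2 := by positivity
  have p3 : 0 < 16 * A * (a * p) := by positivity
  have p4 : 0 < 16 * A * (a * p) ^ 2 := by positivity
  refine ⟨h0, g2, up hδ.le (by linarith) g3, up hδ2.le (by linarith) g4, ?_⟩
  have hHh : 0 ≤ H - h := by linarith
  have hH0 : 0 < H := by linarith
  set r := p - u with hr
  rcases le_or_gt r (2 * s) with hrs | hrs
  · left
    have hM' : M ≤ 64 * A * (s ^ 3) ^ 2 := by
      refine hMle.trans ?_
      calc A * max r s ^ 6 ≤ A * (2 * s) ^ 6 := by gcongr; exact max_le hrs (by linarith)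
        _ = _ := by ring
    have hMε : M / (s ^ 3) ^ 2 ≤ 64 * A := by rwa [div_le_iff₀ (by positivity)]
    have hMε1 : M / s ^ 3 ≤ 64 * A := by
      rw [div_le_iff₀ (by positivity)]
      refine hM'.trans (mul_le_mul_of_nonneg_left ?_ (by positivity))
      rw [sq]
      exact mul_le_of_le_one_right (by positivity) (pow_le_one₀ hs.le (by linarith))
    constructor
    · refine up (Q := 64 * A * K) hδ2.le (by linarith) ?_
      rw [mul_assoc (64 * A)]
      exact mul_le_mul hMε1 g4 hHh (by positivity)
    · refine up (Q := 64 * A * K ^ 2) hδ2.le (by linarith) ?_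
      rw [mul_assoc (64 * A), ← mul_pow]
      exact mul_le_mul hMε (pow_le_pow_left₀ hH0.le g3 2) (by positivity) (by positivity)
  have hr0 : 0 < r := by linarith
  have hr1 : r ≤ 1 := by linarith
  have hM' : M ≤ A * r ^ 6 := by rwa [max_eq_left (by linarith)] at hMle
  rcases le_or_gt (4 * δ) r with hδr | hδr
  · left
    have hκ : ∀ t ∈ Icc u (u + 2 * δ), t ≤ p - s ∧ r / 2 ≤ p - t := fun t ht =>
      ⟨by linarith [ht.2], by linarith [ht.2]⟩
    obtain ⟨-, -, k3, k4⟩ := second_diff_bounds dΦ dΦ1 hδ n2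
      (B1 := a * p * s ^ 3 / (r / 2) ^ 2) (B2 := 2 * a * p * s ^ 3 / (r / 2) ^ 3)
      (fun t ht => by
        unfold halfMapDeriv
        rw [if_pos (hκ t ht).1]
        have := (hκ t ht).2
        gcongr)
      (fun t ht => by
        unfold halfMapDerivTwo
        rw [if_pos (hκ t ht).1]
        have := (hκ t ht).2
        gcongr)
    rw [← hH] at k3 k4
    rw [← hh] at k4
    have q0 : (r ^ 3) ≤ 1 := pow_le_one₀ hr0.le hr1
    constructor
    · refine up (Q := 16 * A * (a * p)) hδ2.le (by linarith) ?_
      calc M / s ^ 3 * (H - h)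
          ≤ A * r ^ 6 / s ^ 3 * (2 * a * p * s ^ 3 / (r / 2) ^ 3 * δ ^ 2) := by gcongr
        _ = 16 * A * (a * p) * δ ^ 2 * r ^ 3 := by field_simp; ring
        _ ≤ 16 * A * (a * p) * δ ^ 2 := mul_le_of_le_one_right (by positivity) q0
    · refine up (Q := 16 * A * (a * p) ^ 2) hδ2.le (by linarith) ?_
      calc M / (s ^ 3) ^ 2 * H ^ 2
          ≤ A * r ^ 6 / (s ^ 3) ^ 2 * (a * p * s ^ 3 / (r / 2) ^ 2 * δ) ^ 2 := by gcongr
        _ = 16 * A * (a * p) ^ 2 * δ ^ 2 * r ^ 2 := by field_simp; ring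
        _ ≤ 16 * A * (a * p) ^ 2 * δ ^ 2 :=
          mul_le_of_le_one_right (by positivity) (pow_le_one₀ hr0.le hr1)
  · right
    refine ⟨up (Q := 8) hδ2.le (by linarith) ?_, up (Q := 16 * A) hδ2.le (by linarith) ?_, ?_⟩
    · calc s ^ 3 ≤ (2 * δ) ^ 3 := by gcongr; linarith
        _ = 8 * δ ^ 2 * δ := by ring
        _ ≤ 8 * δ ^ 2 := mul_le_of_le_one_right (by positivity) hδ1
    · calc M ≤ A * r ^ 6 := hM'
        _ = A * r ^ 2 * r ^ 4 := by ring
        _ ≤ A * r ^ 2 := mul_le_of_le_one_right (by positivity) (pow_le_one₀ hr0.le hr1)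
        _ ≤ A * (4 * δ) ^ 2 := by gcongr
        _ = _ := by ring
    · refine le_trans ?_ g1
      unfold halfMapDeriv
      rw [if_pos (by linarith), ← hr]
      have : r ^ 2 / 4 ≤ δ := by nlinarith
      calc a * p / 4 * s ^ 3 = a * p * s ^ 3 / r ^ 2 * (r ^ 2 / 4) := by field_simp
        _ ≤ _ := by gcongr

/-- Three consecutive mesh points on which the scheme is consistent of order `δ²`. -/
def IsGoodStep (c ε C b δ xL x xR : ℝ) : Prop :=
  0 ≤ xL ∧ xL < x ∧ x < xR ∧ xR ≤ 1 ∧ ∃ M, (∀ t ∈ Icc xL xR, layer c ε t ≤ M) ∧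
    (x - xL) ^ 2 + (xR - x) ^ 2 ≤ C * δ ^ 2 ∧ |(xR - x) - (x - xL)| ≤ C * δ ^ 2 ∧
    ((M / ε * |(xR - x) - (x - xL)| ≤ C * δ ^ 2 ∧
        M / ε ^ 2 * ((x - xL) ^ 2 + (xR - x) ^ 2) ≤ C * δ ^ 2) ∨
      (ε ≤ C * δ ^ 2 ∧ M ≤ C * δ ^ 2 ∧ b * ε ≤ x - xL ∧ b * ε ≤ xR - x))

lemma layer_one_sub (c ε t : ℝ) : layer c ε (1 - t) = layer c ε t := by
  unfold layer
  rw [sub_sub_cancel, add_comm]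

lemma IsGoodStep.reflect {c ε C b δ xL x xR : ℝ} (h : IsGoodStep c ε C b δ xL x xR) :
    IsGoodStep c ε C b δ (1 - xR) (1 - x) (1 - xL) := by
  obtain ⟨h1, h2, h3, h4, M, hM, h5, h6, h7⟩ := h
  have e1 : 1 - x - (1 - xR) = xR - x := by ring
  have e2 : 1 - xL - (1 - x) = x - xL := by ring
  refine ⟨by linarith, by linarith, by linarith, by linarith, M, fun t ht => ?_, ?_⟩
  · rw [← layer_one_sub]
    exact hM _ ⟨by linarith [ht.2], by linarith [ht.1]⟩
  · rw [e1, e2, abs_sub_comm, add_comm ((xR - x) ^ 2)]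
    exact ⟨h5, h6, h7.imp id fun ⟨h8, h9, h10, h11⟩ => ⟨h8, h9, h11, h10⟩⟩

lemma layer_le_of_mem {c ε xL xR t : ℝ} (hc : 0 ≤ c) (hε : 0 < ε) (hx : xR ≤ 1 - xL)
    (ht : t ∈ Icc xL xR) : layer c ε t ≤ 2 * Real.exp (-(c * xL / ε)) := by
  have h1 := ht.1
  have h2 : xL ≤ 1 - t := by linarith [ht.2]
  unfold layer
  rw [two_mul]
  gcongr

lemma isGoodStep_of_steps {c ε C b δ xL x xR H : ℝ} (hc : 0 ≤ c) (hε : 0 < ε) (hC : 0 < C)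
    (h0 : 0 ≤ xL) (hx : xL < x) (hxR : x - xL ≤ xR - x) (hR : xR ≤ 1 - xL) (hH : xR - x ≤ H)
    (h1 : H ≤ C * δ) (h2 : H - (x - xL) ≤ C * δ ^ 2)
    (h3 : (2 * Real.exp (-(c * xL / ε)) / ε * (H - (x - xL)) ≤ C * δ ^ 2 ∧
        2 * Real.exp (-(c * xL / ε)) / ε ^ 2 * H ^ 2 ≤ C * δ ^ 2) ∨
      (ε ≤ C * δ ^ 2 ∧ 2 * Real.exp (-(c * xL / ε)) ≤ C * δ ^ 2 ∧ b * ε ≤ x - xL)) :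
    IsGoodStep c ε (2 * C + 2 * C ^ 2) b δ xL x xR := by
  have hδ2 : 0 ≤ δ ^ 2 := sq_nonneg δ
  have hh : 0 < x - xL := sub_pos.2 hx
  have habs : |(xR - x) - (x - xL)| ≤ H - (x - xL) := by
    rw [abs_of_nonneg (by linarith)]
    linarith
  have hsq : (x - xL) ^ 2 + (xR - x) ^ 2 ≤ 2 * H ^ 2 := by
    have := pow_le_pow_left₀ hh.le (hxR.trans hH) 2
    have := pow_le_pow_left₀ (hh.le.trans hxR) hH 2
    linarith
  have hH2 : H ^ 2 ≤ C ^ 2 * δ ^ 2 := by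
    rw [← mul_pow]
    exact pow_le_pow_left₀ (hh.le.trans (hxR.trans hH)) h1 2
  have n1 : 0 ≤ C * δ ^ 2 := by positivity
  have n2 : 0 ≤ C ^ 2 * δ ^ 2 := by positivity
  have hup : ∀ {z : ℝ}, z ≤ C * δ ^ 2 → z ≤ (2 * C + 2 * C ^ 2) * δ ^ 2 := fun hz => by linarith
  refine ⟨h0, hx, by linarith, by linarith, 2 * Real.exp (-(c * xL / ε)),
    fun t ht => layer_le_of_mem hc hε hR ht, by linarith, hup (habs.trans h2), ?_⟩
  refine h3.imp (fun h => ⟨hup (le_trans ?_ h.1), ?_⟩)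
    (fun h => ⟨hup h.1, hup h.2.1, h.2.2, h.2.2.trans hxR⟩)
  · gcongr
  · calc _ ≤ 2 * Real.exp (-(c * xL / ε)) / ε ^ 2 * (2 * H ^ 2) := by gcongr
      _ = 2 * (2 * Real.exp (-(c * xL / ε)) / ε ^ 2 * H ^ 2) := by ring
      _ ≤ _ := by linarith [h.2]

lemma rpow_one_third_pow_three {ε : ℝ} (hε : 0 < ε) : (ε ^ ((1:ℝ) / 3)) ^ 3 = ε := by
  rw [← Real.rpow_natCast, ← Real.rpow_mul hε.le]
  norm_num

lemma rpow_one_third_sq {ε : ℝ} (hε : 0 < ε) : (ε ^ ((1:ℝ) / 3)) ^ 2 = ε ^ ((2:ℝ) / 3) := by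
  rw [← Real.rpow_natCast, ← Real.rpow_mul hε.le]
  norm_num

lemma bphi_eq_halfMap {a ε p t : ℝ} (hε : 0 < ε) (ht : t ≤ 1 / 2) :
    bphi a ε p t = halfMap a p (ε ^ ((1:ℝ) / 3)) (bomega a ε p) t := by
  have hs : 0 < ε ^ ((1:ℝ) / 3) := Real.rpow_pos_of_pos hε _
  have h3 := rpow_one_third_pow_three hε
  unfold bphi bpi bkappa halfMap
  rw [if_pos ht]
  generalize ε ^ ((1:ℝ) / 3) = s at *
  subst h3
  rw [sub_sub_cancel]
  split_ifs
  · rfl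
  · field_simp

lemma halfMap_half {a ε p : ℝ} (hε : 0 < ε) (hp : p < 1 / 2) :
    halfMap a p (ε ^ ((1:ℝ) / 3)) (bomega a ε p) (1 / 2) = 1 / 2 := by
  have hs : 0 < ε ^ ((1:ℝ) / 3) := Real.rpow_pos_of_pos hε _
  unfold halfMap bomega
  rw [← rpow_one_third_sq hε]
  generalize ε ^ ((1:ℝ) / 3) = s at *
  rw [if_neg (by linarith)]
  have h : 1 / 2 - (p - s) ≠ 0 := by linarith
  generalize hα : p - s = α at *
  generalize hd : 1 / 2 - α = d at *
  field_simp
  ring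

lemma bphi_one_sub {a ε p t : ℝ} (hε : 0 < ε) (hp : p < 1 / 2) :
    bphi a ε p (1 - t) = 1 - bphi a ε p t := by
  rcases lt_trichotomy t (1 / 2) with ht | rfl | ht
  · have h1 : ¬ (1 - t ≤ 1 / 2) := by linarith
    unfold bphi
    rw [if_neg h1, if_pos ht.le, sub_sub_cancel]
  · rw [show (1:ℝ) - 1 / 2 = 1 / 2 by norm_num, bphi_eq_halfMap hε le_rfl, halfMap_half hε hp]
    norm_num
  · have h1 : 1 - t ≤ 1 / 2 := by linarith
    unfold bphi
    rw [if_neg ht.not_ge, if_pos h1, sub_sub_cancel]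

lemma halfMap_zero {a p s ω : ℝ} (hsp : s < p) : halfMap a p s ω 0 = 0 := by
  unfold halfMap
  rw [if_pos (by linarith)]
  simp

lemma bphi_zero {a ε p : ℝ} (hε : 0 < ε) (hsp : ε ^ ((1:ℝ) / 3) < p) : bphi a ε p 0 = 0 := by
  rw [bphi_eq_halfMap hε (by norm_num), halfMap_zero hsp]

lemma bphi_one {a ε p : ℝ} (hε : 0 < ε) (hp : p < 1 / 2) (hsp : ε ^ ((1:ℝ) / 3) < p) :
    bphi a ε p 1 = 1 := by
  have := bphi_one_sub (a := a) (t := 0) hε hp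
  rwa [sub_zero, bphi_zero hε hsp, sub_zero] at this

lemma bomega_le {a ε p : ℝ} (ha : 0 < a) (hε : 0 < ε) (hp : p < 1 / 2)
    (hsp : ε ^ ((1:ℝ) / 3) < p) : bomega a ε p ≤ (1 / 2 - p)⁻¹ ^ 3 * (1 / 2) := by
  have hs : 0 < ε ^ ((1:ℝ) / 3) := Real.rpow_pos_of_pos hε _
  unfold bomega
  rw [← rpow_one_third_sq hε]
  generalize ε ^ ((1:ℝ) / 3) = s at *
  have h1 : 0 < 1 / 2 - p := by linarith
  have h2 : 0 < 1 / 2 - (p - s) := by linarith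
  have h3 : 0 < p - s := by linarith
  have h4 : 0 < p := by linarith
  refine mul_le_mul_of_nonneg (pow_le_pow_left₀ (by positivity) (inv_anti₀ h1 (by linarith)) 3)
    ?_ (by positivity) (by norm_num)
  have : 0 < a * (p * (1 / 2 - (p - s)) ^ 2 + p * (1 / 2 - (p - s)) * s + (p - s) * s ^ 2) := by
    positivity
  linarith

/-- The Bakhvalov-type mesh consists of good steps, uniformly in `ε`. -/
lemma exists_isGoodStep_bphi {a p c : ℝ} (ha : 0 < a) (hp0 : 0 < p) (hp : p < 1 / 2) (hc : 0 < c) :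
    ∃ C > 0, ∃ b > 0, ∀ ε > 0, ε ^ ((1:ℝ) / 3) < p → 0 ≤ bomega a ε p → ∀ δ u : ℝ, 0 < δ →
      δ ≤ 1 / 4 → 0 ≤ u → u + 2 * δ ≤ 1 → (u + 2 * δ ≤ 1 / 2 ∨ u + δ = 1 / 2 ∨ 1 / 2 ≤ u) →
      IsGoodStep c ε C b δ (bphi a ε p u) (bphi a ε p (u + δ)) (bphi a ε p (u + 2 * δ)) := by
  have hd : 0 < 1 / 2 - p := by linarith
  obtain ⟨C, hC, b, hb, H⟩ := exists_halfMap_steps ha hp0 (by linarith) hc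
    (W := (1 / 2 - p)⁻¹ ^ 3 * (1 / 2)) (by positivity)
  refine ⟨2 * C + 2 * C ^ 2, by positivity, b, hb, fun ε hε hsp hω => ?_⟩
  have hs : 0 < ε ^ ((1:ℝ) / 3) := Real.rpow_pos_of_pos hε _
  have hmono := strictMono_halfMap (s := ε ^ ((1:ℝ) / 3)) ha hp0 hs hω
  have left : ∀ δ u : ℝ, 0 < δ → δ ≤ 1 / 4 → 0 ≤ u → (u + 2 * δ ≤ 1 / 2 ∨ u + δ = 1 / 2) →
      IsGoodStep c ε (2 * C + 2 * C ^ 2) b δ (bphi a ε p u) (bphi a ε p (u + δ))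
        (bphi a ε p (u + 2 * δ)) := by
    intro δ u hδ hδ4 hu hcase
    have hu1 : u + δ ≤ 1 / 2 := by rcases hcase with h | h <;> linarith
    obtain ⟨k1, k2, k3, k4, k5⟩ := H _ _ δ u hs hsp hω (bomega_le ha hε hp hsp) hδ (by linarith) hu
      (by linarith) _ _ _ rfl rfl rfl
    rw [rpow_one_third_pow_three hε] at k5
    have e0 := bphi_eq_halfMap (a := a) (p := p) hε (show u ≤ 1 / 2 by linarith)
    have e1 := bphi_eq_halfMap (a := a) (p := p) hε hu1
    have h0 : 0 ≤ halfMap a p (ε ^ ((1:ℝ) / 3)) (bomega a ε p) u := by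
      rw [← halfMap_zero hsp]
      exact hmono.monotone hu
    have hle : ∀ t ≤ 1 / 2, halfMap a p (ε ^ ((1:ℝ) / 3)) (bomega a ε p) t ≤ 1 / 2 := by
      intro t ht
      rw [← halfMap_half (a := a) hε hp]
      exact hmono.monotone ht
    rcases hcase with h | h
    · have e2 := bphi_eq_halfMap (a := a) (p := p) hε h
      have l2 := hle _ h
      have l0 := hle u (by linarith)
      rw [e0, e1, e2]
      exact isGoodStep_of_steps hc.le hε hC h0 (sub_pos.1 k1) k2 (by linarith) le_rfl k3 k4 k5
    · have e2 : bphi a ε p (u + 2 * δ) = 1 - halfMap a p (ε ^ ((1:ℝ) / 3)) (bomega a ε p) u := by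
        rw [show u + 2 * δ = 1 - u by linarith, bphi_one_sub hε hp, e0]
      have e3 : halfMap a p (ε ^ ((1:ℝ) / 3)) (bomega a ε p) (u + δ) = 1 / 2 := by
        rw [h, halfMap_half hε hp]
      rw [e0, e1, e2]
      exact isGoodStep_of_steps hc.le hε hC h0 (sub_pos.1 k1) (by linarith) le_rfl (by linarith)
        k3 k4 k5
  intro δ u hδ hδ4 hu hu1 hcase
  rcases hcase with h | h | h
  · exact left δ u hδ hδ4 hu (Or.inl h)
  · exact left δ u hδ hδ4 hu (Or.inr h)
  · have := (left δ (1 - (u + 2 * δ)) hδ hδ4 (by linarith) (Or.inl (by linarith))).reflect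
    rw [← bphi_one_sub hε hp, ← bphi_one_sub hε hp, ← bphi_one_sub hε hp] at this
    convert this using 2 <;> ring

lemma mul_le_of_row_sub {γ q m zs ws D yL y yR YL Y YR gL g gR vL v vR bL b bR ρ E : ℝ}
    (hz : 0 < zs) (hw : 0 < ws) (hD : 0 < D) (hq : 0 < q) (hγ : 0 ≤ γ)
    (hm : 0 < m) (hbL : m ≤ bL) (hbL' : bL ≤ γ) (hb : m ≤ b) (hbR : m ≤ bR) (hbR' : bR ≤ γ)
    (eL : gL - vL = bL * (yL - YL)) (e : g - v = b * (y - Y)) (eR : gR - vR = bR * (yR - YR))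
    (hE : |y - Y| = E) (hEL : |yL - YL| ≤ E) (hER : |yR - YR| ≤ E)
    (h0 : (q + 2) * (γ * ((YL - Y) / zs + (YR - Y) / ws) / D - v) + γ * (YL - 2 * Y + YR)
      - (vL - 2 * v + vR) = 0)
    (hρ : |(q + 2) * (γ * ((yL - y) / zs + (yR - y) / ws) / D - g) + γ * (yL - 2 * y + yR)
      - (gL - 2 * g + gR)| ≤ ρ) : (q + 2) * m * E ≤ ρ := by
  set P := (q + 2) * γ / (zs * D) with hP
  set Q := (q + 2) * γ / (ws * D) with hQ
  have hP0 : 0 ≤ P := by positivity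
  have hQ0 : 0 ≤ Q := by positivity
  have key : (P + Q + 2 * γ + q * b) * (y - Y) = (P + γ - bL) * (yL - YL)
      + (Q + γ - bR) * (yR - YR) + -((q + 2) * (γ * ((yL - y) / zs + (yR - y) / ws) / D - g)
        + γ * (yL - 2 * y + yR) - (gL - 2 * g + gR)) := by
    have hgL : gL = vL + bL * (yL - YL) := by linarith
    have hg : g = v + b * (y - Y) := by linarith
    have hgR : gR = vR + bR * (yR - YR) := by linarith
    rw [hgL, hg, hgR, hP, hQ]
    linear_combination h0
  have hb0 : 0 < b := hm.trans_le hb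
  have h1 := abs_add_three ((P + γ - bL) * (yL - YL)) ((Q + γ - bR) * (yR - YR))
    (-((q + 2) * (γ * ((yL - y) / zs + (yR - y) / ws) / D - g)
        + γ * (yL - 2 * y + yR) - (gL - 2 * g + gR)))
  rw [← key, abs_neg, abs_mul, abs_mul, abs_mul, hE,
    abs_of_nonneg (show 0 ≤ P + Q + 2 * γ + q * b by positivity),
    abs_of_nonneg (show 0 ≤ P + γ - bL by linarith),
    abs_of_nonneg (show 0 ≤ Q + γ - bR by linarith)] at h1
  have h2 : (P + γ - bL) * |yL - YL| ≤ (P + γ - bL) * E :=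
    mul_le_mul_of_nonneg_left hEL (by linarith)
  have h3 : (Q + γ - bR) * |yR - YR| ≤ (Q + γ - bR) * E :=
    mul_le_mul_of_nonneg_left hER (by linarith)
  have hE0 : 0 ≤ E := hE ▸ abs_nonneg _
  have h4 : q * m * E ≤ q * b * E := by gcongr
  have h5 : m * E ≤ bL * E := by gcongr
  have h6 : m * E ≤ bR * E := by gcongr
  linarith

/-- Stability of the scheme: the error is controlled by the residual of the exact solution. -/
lemma IsReaction.abs_sub_le_of_residual {m γ q β ρ : ℝ} {f : ℝ → ℝ → ℝ}
    {Df : ℝ × ℝ → (ℝ × ℝ →L[ℝ] ℝ)} {DDf : ℝ × ℝ → (ℝ × ℝ →L[ℝ] (ℝ × ℝ →L[ℝ] ℝ))}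
    (hF : IsReaction m γ f Df DDf) (hm : 0 < m) (hγ : 0 < γ) (hq : 0 < q) (hβ : 0 < β)
    (hρ : 0 ≤ ρ) {N : ℕ} {x : ℕ → ℝ} (hx : ∀ j ≤ N, x j ∈ Icc (0:ℝ) 1)
    (hmono : ∀ j, j + 2 ≤ N → x j < x (j + 1) ∧ x (j + 1) < x (j + 2)) {y : ℝ → ℝ}
    (hy0 : y (x 0) = 0) (hyN : y (x N) = 0)
    (hres : ∀ j, j + 2 ≤ N →
      |rowResidual γ q β y (fun t => f t (y t)) (x j) (x (j + 1)) (x (j + 2))| ≤ ρ)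
    {ybar : Fin (N + 1) → ℝ} (hybar : schemeF N x f γ q β ybar = 0) (i : Fin (N + 1)) :
    |y (x i) - ybar i| ≤ ρ / ((q + 2) * m) := by
  obtain ⟨i0, hmax⟩ := Finite.exists_max fun i : Fin (N + 1) => |y (x i) - ybar i|
  refine (hmax i).trans ?_
  have hrow := congrFun hybar i0
  have hnn : 0 ≤ ρ / ((q + 2) * m) := by positivity
  obtain ⟨k, hk⟩ := i0
  unfold schemeF at hrow
  simp only [Pi.zero_apply] at hrow
  rcases k with _ | j
  · simp only [if_true, Nat.zero_lt_succ, dif_pos] at hrow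
    have h0 : ybar 0 = 0 := hrow
    simpa [hy0, h0] using hnn
  rw [if_neg (Nat.succ_ne_zero j)] at hrow
  by_cases hjN : j + 1 = N
  · subst hjN
    simp only [if_true, Nat.lt_succ_self, dif_pos] at hrow
    simpa [hyN, hrow] using hnn
  have hj : j + 2 ≤ N := by omega
  rw [if_neg hjN] at hrow
  simp only [Nat.add_sub_cancel, dif_pos (show j < N + 1 by omega), dif_pos hk,
    dif_pos (show j + 1 + 1 < N + 1 by omega)] at hrow
  obtain ⟨m1, m2⟩ := hmono j hj
  have hz : 0 < β * (x (j + 1) - x j) := mul_pos hβ (sub_pos.2 m1)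
  have hw : 0 < β * (x (j + 2) - x (j + 1)) := mul_pos hβ (sub_pos.2 m2)
  have hrow' := (fitted_row_eq hγ hz hw).symm.trans hrow
  obtain ⟨bL, l1, l2, l3⟩ := hF.mono (x j) (hx j (by omega)) (y (x j)) (ybar ⟨j, by omega⟩)
  obtain ⟨b, c1, c2, c3⟩ := hF.mono (x (j + 1)) (hx (j + 1) (by omega)) (y (x (j + 1)))
    (ybar ⟨j + 1, hk⟩)
  obtain ⟨bR, r1, r2, r3⟩ := hF.mono (x (j + 2)) (hx (j + 2) hj) (y (x (j + 2)))
    (ybar ⟨j + 2, by omega⟩)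
  rw [le_div_iff₀ (by positivity), mul_comm]
  exact mul_le_of_row_sub (Real.sinh_pos_iff.2 hz) (Real.sinh_pos_iff.2 hw)
    (add_pos (halfTanh_pos hz) (halfTanh_pos hw)) hq hγ.le hm l1 l2 c1 r1 r2 l3 c3 r3 rfl
    (hmax ⟨j, by omega⟩) (hmax ⟨j + 2, by omega⟩) hrow' (hres j hj)

lemma hasDerivWithinAt_derivWithin_of_contDiffOn_two {y : ℝ → ℝ} {s : Set ℝ}
    (hs : UniqueDiffOn ℝ s) (hy : ContDiffOn ℝ 2 y s) {t : ℝ} (ht : t ∈ s) :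
    HasDerivWithinAt y (derivWithin y s t) s t ∧
      HasDerivWithinAt (derivWithin y s) (iteratedDerivWithin 2 y s t) s t := by
  have h1 : ContDiffOn ℝ 1 (derivWithin y s) s := hy.derivWithin hs (by norm_num)
  refine ⟨(hy.differentiableOn (by norm_num) t ht).hasDerivWithinAt, ?_⟩
  have h2 := (h1.differentiableOn (by norm_num) t ht).hasDerivWithinAt
  rwa [iteratedDerivWithin_succ', iteratedDerivWithin_one]

/-- Combining consistency on coarse and fine steps: the residual on a good step is of second order
in the mesh parameter. -/
lemma exists_abs_rowResidual_le {γ q C₁ C₂ b c : ℝ} (hγ : 0 < γ) (hq : 0 < q) (hC₁ : 0 < C₁)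
    (hC₂ : 0 < C₂) (hb : 0 < b) :
    ∃ K > 0, ∀ ε > 0, ε ≤ 1 → ∀ y y1 g g1 g2 v v1 v2 : ℝ → ℝ,
      HasLayerBounds C₁ c ε y y1 g g1 g2 v v1 v2 → ∀ δ xL x xR : ℝ,
      IsGoodStep c ε C₂ b δ xL x xR → |rowResidual γ q (√γ / ε) y g xL x xR| ≤ K * δ ^ 2 := by
  have hsγ : 0 < √γ := Real.sqrt_pos.2 hγ
  have hT : 0 < halfTanh (√γ * b) := halfTanh_pos (by positivity)
  set K₁ := (q + 2) * (4 * γ * C₁ + 8 * C₁) + 4 * γ * C₁ + 4 * C₁ with hK₁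
  set K₂ := (q + 2) * (γ * (C₁ / √γ + 4 * C₁ / (√γ * b)) / halfTanh (√γ * b) + 2 * C₁)
        + γ * (10 * C₁) + 8 * C₁ with hK₂
  have h1 : 0 < K₁ := by positivity
  have h2 : 0 < K₂ := by positivity
  refine ⟨(K₁ + K₂) * C₂, by positivity, ?_⟩
  rintro ε hε hε1 y y1 g g1 g2 v v1 v2 hS δ xL x xR
    ⟨hL, hLx, hxR, hR, M, hM, s1, s2, ⟨s3, s4⟩ | ⟨s3, s4, s5, s6⟩⟩
  · have hβγ : (√γ / ε) ^ 2 * ε ^ 2 = γ := by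
      rw [div_pow, div_mul_cancel₀ _ (by positivity), Real.sq_sqrt hγ.le]
    have := hS.rowResidual_le_of_fine hC₁.le (by positivity) hε hβγ hq.le hL hLx hxR hR hM s1 s2
      s3 s4
    have : 0 ≤ K₂ * (C₂ * δ ^ 2) := by positivity
    linarith
  · have := hS.rowResidual_le_of_coarse hC₁.le hγ hε hε1 rfl hq.le hL hLx hxR hR hM s1 s2 s3 s4
      hb s5 s6
    have : 0 ≤ K₁ * (C₂ * δ ^ 2) := by positivity
    linarith

end

/-- Second-order `ε`-uniform convergence of the scheme on the Bakhvalov-type mesh: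
`max_{0 ≤ i ≤ N} |y(xᵢ) - ȳᵢ| ≤ C/N²` with `C` independent of `N` and `ε`. -/
theorem uniform_convergence_bakhvalov
    (k : ℕ) (hk : 2 ≤ k) (m γ q : ℝ) (hm : 0 < m) (hq : 0 < q)
    (f : ℝ → ℝ → ℝ)
    (hf : ContDiffOn ℝ k (Function.uncurry f) (Set.Icc 0 1 ×ˢ Set.univ))
    (hfy : ∀ x y : ℝ, x ∈ Set.Icc (0:ℝ) 1 →
      m ≤ deriv (f x) y ∧ deriv (f x) y ≤ γ)
    (εstar p a : ℝ)
    (hεstar : εstar ∈ Set.Ioo (0:ℝ) (1/8))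
    (hp : p ∈ Set.Ioo (εstar ^ ((1:ℝ)/3)) (1/2))
    (ha : 0 < a)
    (hω : ∀ ε ∈ Set.Ioc (0:ℝ) εstar, 0 ≤ bomega a ε p) :
    ∃ C > 0, ∀ ε ∈ Set.Ioc (0:ℝ) εstar, ∀ N : ℕ, Even N → 4 ≤ N →
      ∀ y : ℝ → ℝ, ContDiffOn ℝ (k + 2) y (Set.Icc 0 1) →
        (∀ t ∈ Set.Icc (0:ℝ) 1,
          ε ^ 2 * iteratedDerivWithin 2 y (Set.Icc 0 1) t = f t (y t)) →
        y 0 = 0 → y 1 = 0 →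
      ∀ ybar : Fin (N + 1) → ℝ,
        schemeF N (fun i => bphi a ε p ((i:ℝ) / N)) f γ q (Real.sqrt γ / ε) ybar = 0 →
        ∀ i : Fin (N + 1),
          |y (bphi a ε p ((i.val:ℝ) / N)) - ybar i| ≤ C / (N:ℝ) ^ 2 := by
  obtain ⟨Df, DDf, hF⟩ := exists_isReaction hk hf hfy
  have hγ : 0 < γ := by
    have := hfy 0 0 (by simp)
    linarith
  have hp0 : 0 < p := (Real.rpow_nonneg hεstar.1.le _).trans_lt hp.1
  obtain ⟨C₁, hC₁, v, v1, v2, hlayer⟩ := hF.exists_layerBounds hm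
  obtain ⟨C₂, hC₂, b, hb, hmesh⟩ := exists_isGoodStep_bphi ha hp0 hp.2 (Real.sqrt_pos.2 hm)
  obtain ⟨K, hK, hres⟩ := exists_abs_rowResidual_le (c := √m) hγ hq hC₁ hC₂ hb
  refine ⟨K / ((q + 2) * m), by positivity, ?_⟩
  rintro ε ⟨hε, hεs⟩ N hN hN4 y hy hode hy0 hy1 ybar hybar i
  have hε8 : ε ≤ 1 / 8 := hεs.trans hεstar.2.le
  have hsp : ε ^ ((1:ℝ) / 3) < p :=
    (Real.rpow_le_rpow hε.le hεs (by norm_num)).trans_lt hp.1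
  have hy2 : ContDiffOn ℝ 2 y (Set.Icc 0 1) := hy.of_le (by exact_mod_cast Nat.le_add_left 2 k)
  have hder := fun t (ht : t ∈ Set.Icc (0:ℝ) 1) =>
    hasDerivWithinAt_derivWithin_of_contDiffOn_two (uniqueDiffOn_Icc zero_lt_one) hy2 ht
  obtain ⟨g1, g2, hS⟩ := hlayer ε hε (by linarith) y _ (fun t ht => (hder t ht).1)
    (fun t ht => by
      rw [← hode t ht, mul_div_cancel_left₀ _ (by positivity)]
      exact (hder t ht).2) hy0 hy1
  have hN0 : (0:ℝ) < N := by exact_mod_cast (by omega : 0 < N)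
  have hstep : ∀ j : ℕ, j + 2 ≤ N → IsGoodStep (√m) ε C₂ b (1 / N) (bphi a ε p ((j:ℝ) / N))
      (bphi a ε p (((j + 1 : ℕ) : ℝ) / N)) (bphi a ε p (((j + 2 : ℕ) : ℝ) / N)) := by
    intro j hj
    obtain ⟨r, rfl⟩ := hN
    have hr : (0:ℝ) < r := by exact_mod_cast (by omega : 0 < r)
    have hj' : (j:ℝ) + 2 ≤ r + r := by exact_mod_cast hj
    have hN4' : (4:ℝ) ≤ r + r := by exact_mod_cast hN4
    have key := hmesh ε hε hsp (hω ε ⟨hε, hεs⟩) (1 / ((r + r : ℕ) : ℝ)) ((j : ℝ) / (r + r : ℕ))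
      (by positivity) (one_div_le_one_div_of_le (by norm_num) (by push_cast; exact hN4'))
      (by positivity)
      (by push_cast; rw [← mul_div_assoc, mul_one, ← add_div, div_le_one (by positivity)]; exact hj')
      (by
        push_cast
        rw [← mul_div_assoc, mul_one, ← add_div, ← add_div, div_le_iff₀ (by positivity),
          div_eq_iff (by positivity), le_div_iff₀ (by positivity)]
        rcases (by omega : j + 2 ≤ r ∨ j + 1 = r ∨ r ≤ j) with h | h | h
        · left
          have : (j:ℝ) + 2 ≤ r := by exact_mod_cast h
          linarith
        · right; left
          have : (j:ℝ) + 1 = r := by exact_mod_cast h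
          linarith
        · right; right
          have : (r:ℝ) ≤ j := by exact_mod_cast h
          linarith)
    convert key using 2 <;> push_cast <;> ring
  have h0 : bphi a ε p (((0:ℕ):ℝ) / N) = 0 := by
    rw [Nat.cast_zero, zero_div, bphi_zero hε hsp]
  have h1 : bphi a ε p ((N:ℝ) / N) = 1 := by
    rw [div_self hN0.ne', bphi_one hε hp.2 hsp]
  have hx : ∀ j ≤ N, bphi a ε p ((j:ℝ) / N) ∈ Set.Icc (0:ℝ) 1 := by
    intro j hj
    rcases Nat.eq_zero_or_pos j with rfl | hj0
    · rw [h0]; simp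
    rcases hj.eq_or_lt with rfl | hjN
    · rw [h1]; simp
    obtain ⟨l, rfl⟩ : ∃ l, j = l + 1 := ⟨j - 1, by omega⟩
    obtain ⟨a1, a2, a3, a4, -⟩ := hstep l (by omega)
    exact ⟨by linarith, by linarith⟩
  have := hF.abs_sub_le_of_residual (x := fun i : ℕ => bphi a ε p ((i:ℝ) / N)) (y := y)
    (ρ := K * (1 / (N:ℝ)) ^ 2) hm hγ hq (div_pos (Real.sqrt_pos.2 hγ) hε) (by positivity) hx
    (fun j hj => ⟨(hstep j hj).2.1, (hstep j hj).2.2.1⟩) (by rw [h0, hy0]) (by rw [h1, hy1])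
    (fun j hj => hres ε hε (by linarith) _ _ _ _ _ _ _ _ hS _ _ _ _ (hstep j hj)) hybar i
  refine this.trans_eq ?_
  field_simp
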